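/- For each fixed k ≥ 1, if ρ_k(n) denotes the k-th row length of the invariant Young diagram of the n-color BBS started from a uniformly random permutation of {1,...,n}, then n^{−1} ρ_k(n) → 1/(k(k+1)) almost surely; equivalently n^{−1}(ρ_1(n)+...+ρ_k(n)) → k/(k+1) almost surely. -/

import Mathlib

open MeasureTheory

/-- One step of the infinite-capacity carrier: the carrier is the multiset of the balls of
positive color it holds (it has infinitely many empty slots). An incoming ball `y ≥ 1`
replaces the largest ball of color strictly smaller than `y` if one exists (otherwise it
fills an empty slot); an incoming `0` ejects the ball of largest color (if any). -/
noncomputable def infStep (x : Multiset ℕ) (y : ℕ) : Multiset ℕ := by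
  classical
  exact if y = 0 then x.erase x.sup
    else y ::ₘ x.erase ((x.filter fun a => a < y).sup)

/-- The color of the ball exiting the infinite-capacity carrier (with `0` for an empty box). -/
noncomputable def infOut (x : Multiset ℕ) (y : ℕ) : ℕ := by
  classical
  exact if y = 0 then x.sup else (x.filter fun a => a < y).sup

/-- The infinite-capacity carrier process over the configuration `X`, started empty. -/
noncomputable def infCarrier (X : ℕ → ℕ) : ℕ → Multiset ℕ
  | 0 => 0
  | s + 1 => infStep (infCarrier X s) (X s)

/-- One step of the κ-color box-ball dynamics `X ↦ X'`, realized by running the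
infinite-capacity carrier over `X` and recording the exiting ball colors. -/
noncomputable def bbsStep (X : ℕ → ℕ) : ℕ → ℕ := fun s => infOut (infCarrier X s) (X s)

/-- `[a, a+n)` is a maximal nonincreasing run of balls (positive colors) in `Y`. -/
def IsMaxRun (Y : ℕ → ℕ) (a n : ℕ) : Prop :=
  1 ≤ n ∧ (∀ i, i < n → 0 < Y (a + i)) ∧
    (∀ i j, i ≤ j → j < n → Y (a + j) ≤ Y (a + i)) ∧
    (∀ b, b + 1 = a → (Y b = 0 ∨ Y b < Y a)) ∧
    (Y (a + n) = 0 ∨ Y (a + (n - 1)) < Y (a + n))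

/-- `rowLen k Y` is the number of maximal nonincreasing runs of length at least `k` in `Y`;
for a fully decomposed configuration this is the `k`-th row length `ρ_k` of the soliton
Young diagram (the number of solitons of length `≥ k`). -/
noncomputable def rowLen (k : ℕ) (Y : ℕ → ℕ) : ℕ :=
  Set.ncard {a | ∃ n, k ≤ n ∧ IsMaxRun Y a n}

/-- `colLen j Y` is the `j`-th column length `λ_j` of the associated Young diagram
(the conjugate of the row lengths); for a fully decomposed configuration this is the `j`-th
longest soliton length. -/
noncomputable def colLen (j : ℕ) (Y : ℕ → ℕ) : ℕ :=
  Set.ncard {i | 1 ≤ i ∧ j ≤ rowLen i Y}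

/-- The BBS configuration associated with a permutation `σ` of `{0,…,n-1}`. -/
noncomputable def permCfg (n : ℕ) (σ : Equiv.Perm (Fin n)) : ℕ → ℕ := fun s =>
  if h : s < n then (σ ⟨s, h⟩ : Fin n).val + 1 else 0

/-- The `i`-th row length of the invariant Young diagram `Λ(X)`: the eventual value of the
`i`-th row length along the BBS trajectory (the number of solitons of length `≥ i`). -/
noncomputable def solRow (i : ℕ) (X : ℕ → ℕ) : ℕ :=
  sSup {v | ∀ᶠ t in Filter.atTop, rowLen i (bbsStep^[t] X) = v}

/-! ### Cost profiles

For `k : ℕ`, the energy of a configuration is the least cost of turning it into a sequence by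
deleting letters, where every deletion costs `1` and every remaining ascent costs `k`. -/

/-- One step of the dynamic program for the energy: the next letter `y` is either deleted, at
cost `1`, or kept. The value at `c` is the least cost after which a letter `c` can be kept for
free. -/
def profStep (k : ℕ) (V : ℕ → ℕ) (y : ℕ) : ℕ → ℕ := fun c =>
  min (V c + 1) (V y + if y < c then k else 0)

/-- The dynamic program `profStep` run over the configuration `X`, with initial values `V`. -/
def profile (k : ℕ) (V X : ℕ → ℕ) : ℕ → ℕ → ℕ
  | 0 => V
  | t + 1 => profStep k (profile k V X t) (X t)

/-- The cost profile of the empty configuration. -/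
def vacuum (k : ℕ) : ℕ → ℕ := fun c => if c = 0 then 0 else k

/-- The least cost of the first `t` letters of `X`. -/
def energy (k : ℕ) (X : ℕ → ℕ) (t : ℕ) : ℕ := profile k (vacuum k) X t 0

/-- The functions that occur as cost profiles. -/
structure IsProfile (k : ℕ) (V : ℕ → ℕ) : Prop where
  mono : Monotone V
  le_add : ∀ c, V c ≤ V 0 + k

theorem isProfile_vacuum (k : ℕ) : IsProfile k (vacuum k) := by
  constructor
  · intro a b h
    simp only [vacuum]
    split_ifs <;> omega
  · intro c
    simp only [vacuum]
    split_ifs <;> omega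

theorem IsProfile.profStep {k : ℕ} {V : ℕ → ℕ} (h : IsProfile k V) (y : ℕ) :
    IsProfile k (profStep k V y) := by
  constructor
  · intro a b hab
    have := h.mono hab
    simp only [_root_.profStep]
    split_ifs <;> omega
  · intro c
    have := h.le_add c
    simp only [_root_.profStep]
    split_ifs <;> omega

theorem IsProfile.profile {k : ℕ} {V : ℕ → ℕ} (h : IsProfile k V) (X : ℕ → ℕ) (t : ℕ) :
    IsProfile k (profile k V X t) := by
  induction t with
  | zero => exact h
  | succ t ih => exact ih.profStep _

theorem IsProfile.le_profStep {k : ℕ} {V : ℕ → ℕ} (h : IsProfile k V) (y c : ℕ) :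
    V c ≤ _root_.profStep k V y c := by
  have h0 := h.mono (Nat.zero_le y)
  have hc := h.le_add c
  simp only [_root_.profStep]
  split_ifs with hy
  · omega
  · have := h.mono (not_lt.mp hy)
    omega

theorem profStep_le (k : ℕ) (V : ℕ → ℕ) (y c : ℕ) : profStep k V y c ≤ V c + 1 :=
  min_le_left _ _

theorem profStep_le_profStep_add {k a : ℕ} {V W : ℕ → ℕ} (h : ∀ c, V c ≤ W c + a) (y c : ℕ) :
    profStep k V y c ≤ profStep k W y c + a := by
  have h1 := h c
  have h2 := h y
  simp only [profStep]
  split_ifs <;> omega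

/-- The profile depends on the letters and on the initial values in a Lipschitz way. -/
theorem profile_le_profile_add {k a : ℕ} {V W : ℕ → ℕ} (hW : IsProfile k W)
    (h : ∀ c, V c ≤ W c + a) (X Y : ℕ → ℕ) (t c : ℕ) :
    profile k V X t c ≤
      profile k W Y t c + a + ((Finset.range t).filter fun s => X s ≠ Y s).card := by
  induction t generalizing c with
  | zero => simpa [profile] using h c
  | succ t ih =>
    rw [Finset.range_add_one, Finset.filter_insert]
    by_cases hxy : X t = Y t
    · simp only [hxy, ne_eq, not_true_eq_false, if_false, profile]
      have := profStep_le_profStep_add (k := k) (fun c => by simpa [add_assoc] using ih c) (Y t) c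
      simpa [add_assoc] using this
    · simp only [ne_eq, hxy, not_false_eq_true, if_true, profile]
      rw [Finset.card_insert_of_notMem (by simp)]
      have h1 := profStep_le k (profile k V X t) (X t) c
      have h2 := (hW.profile Y t).le_profStep (Y t) c
      have h3 := ih c
      simp only [ne_eq] at h3
      omega

theorem energy_zero_left (X : ℕ → ℕ) (t : ℕ) : energy 0 X t = 0 := by
  have h : ∀ c, profile 0 (vacuum 0) X t c = 0 := by
    induction t with
    | zero => intro c; simp [profile, vacuum]
    | succ t ih => intro c; simp [profile, profStep, ih]
  exact h 0

theorem energy_succ_of_eq_zero {k : ℕ} {X : ℕ → ℕ} {t : ℕ} (h : X t = 0) :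
    energy k X (t + 1) = energy k X t := by
  simp [energy, profile, profStep, h]

theorem energy_eq_of_le {k : ℕ} {X : ℕ → ℕ} {n t : ℕ} (h : ∀ s, n ≤ s → X s = 0)
    (hnt : n ≤ t) : energy k X t = energy k X n := by
  induction t, hnt using Nat.le_induction with
  | base => rfl
  | succ t hnt ih => rw [energy_succ_of_eq_zero (h t hnt), ih]

/-! ### Invariance of the energy -/

/-- The transfer of a cost profile through the infinite-capacity carrier `z`. -/
def transfer (V : ℕ → ℕ) (z : Multiset ℕ) : ℕ → ℕ
  | 0 => V 0
  | c + 1 => min (V c) (transfer V z c + z.count c)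

theorem transfer_congr {V : ℕ → ℕ} {z z' : Multiset ℕ} {c : ℕ}
    (h : ∀ d, d < c → z.count d = z'.count d) : transfer V z c = transfer V z' c := by
  induction c with
  | zero => rfl
  | succ c ih =>
    simp only [transfer]
    rw [ih fun d hd => h d (by omega), h c (by omega)]

theorem transfer_zero_right {V : ℕ → ℕ} (hV : Monotone V) (c : ℕ) : transfer V 0 c = V 0 := by
  induction c with
  | zero => rfl
  | succ c ih => simpa [transfer, ih] using hV (Nat.zero_le c)

theorem transfer_le {V : ℕ → ℕ} (hV : Monotone V) (z : Multiset ℕ) (c : ℕ) :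
    transfer V z c ≤ V c := by
  cases c with
  | zero => exact le_rfl
  | succ c => exact (min_le_left _ _).trans (hV (Nat.le_succ c))

theorem transfer_mono {V : ℕ → ℕ} (hV : Monotone V) (z : Multiset ℕ) :
    Monotone (transfer V z) :=
  monotone_nat_of_le_succ fun c => le_min (transfer_le hV z c) (Nat.le_add_right _ _)

/-- Exchange relation between letters and the infinite-capacity carrier: if the letter `y`
ejects `w` from the carrier, then transferring a profile and reading `y` amounts to reading `w`
and transferring the profile through the new carrier. -/
theorem transfer_profStep {k : ℕ} {V : ℕ → ℕ} (hV : IsProfile k V) {z : Multiset ℕ}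
    (h0 : 0 ∉ z) {y w : ℕ} (hwy : w < y) (hw : w = 0 ∨ w ∈ z) (hmax : ∀ a ∈ z, a < y → a ≤ w)
    {c : ℕ} (hc : 1 ≤ c) :
    transfer (profStep k V w) (y ::ₘ z.erase w) c =
      min (transfer V z c + 1) (transfer V z y + if y < c then k else 0) := by
  have hU := transfer_mono hV.mono z
  have hUV := transfer_le hV.mono z
  have hV0 : ∀ c, V 0 ≤ transfer V z c := fun c => hU (Nat.zero_le c)
  have hcount : ∀ d, w < d → d < y → z.count d = 0 := fun d h1 h2 =>
    Multiset.count_eq_zero.2 fun hd => by have := hmax d hd h2; omega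
  have hz0 : z.count 0 = 0 := Multiset.count_eq_zero.2 h0
  have hconst : ∀ c, w < c → c ≤ y → transfer V z c = transfer V z (w + 1) := by
    intro c h1
    induction c, (show w + 1 ≤ c from h1) using Nat.le_induction with
    | base => intro _; rfl
    | succ c h1 ih =>
      intro h2
      have e := ih (by omega) (by omega)
      have := hUV c
      simp only [transfer] at e ⊢
      rw [hcount c (by omega) (by omega)]
      omega
  have hy := hconst y hwy le_rfl
  have hw1 : transfer V z (w + 1) = min (V w) (transfer V z w + z.count w) := rfl
  have hww : w = 0 ∨ 1 ≤ z.count w := hw.imp_right fun h => Multiset.one_le_count_iff_mem.2 h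
  have hcz : ∀ d, (y ::ₘ z.erase w).count d =
      (z.count d - if d = w then 1 else 0) + if d = y then 1 else 0 := by
    intro d
    rw [Multiset.count_cons]
    by_cases h : d = w
    · subst h; simp
    · simp [h, Multiset.count_erase_of_ne h]
  induction c, hc using Nat.le_induction with
  | base =>
    have e1 : transfer (profStep k V w) (y ::ₘ z.erase w) 1 = profStep k V w 0 := by
      simp [transfer, hcz, hz0]
    have e2 : transfer V z 1 = V 0 := by simp [transfer]
    have h3 := hV0 w
    rw [e1, e2, hy, hw1]
    simp only [profStep, Nat.not_lt_zero, if_false, add_zero]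
    rw [if_neg (by omega : ¬ y < 1)]
    rcases hww with h | h
    · subst h
      simp [hz0, transfer]
    · omega
  | succ c hc ih =>
    have hs : transfer (profStep k V w) (y ::ₘ z.erase w) (c + 1) =
      min (profStep k V w c) (transfer (profStep k V w) (y ::ₘ z.erase w) c +
        (y ::ₘ z.erase w).count c) := rfl
    have hs' : transfer V z (c + 1) = min (V c) (transfer V z c + z.count c) := rfl
    rw [hs, ih, hcz, hy]
    simp only [profStep]
    have a0 := hV0 w
    have a1 := hV.le_add c
    rcases lt_trichotomy c w with h | h | h
    · have a2 := hU (show c + 1 ≤ w by omega)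
      rw [if_neg (by omega), if_neg (by omega), if_neg (by omega), if_neg (by omega),
        if_neg (by omega)]
      omega
    · subst h
      rw [if_neg (by omega), if_neg (by omega), if_pos rfl, if_neg (by omega), if_neg (by omega)]
      omega
    · have a3 := hV.mono h.le
      have a4 := hV0 c
      rw [if_pos (by omega), if_neg (by omega : ¬ c = w)]
      rcases lt_trichotomy c y with h' | h' | h'
      · have a2 := hconst c (by omega) (by omega)
        have a5 := hcount c (by omega) (by omega)
        rw [if_neg (by omega), if_neg (by omega), if_neg (by omega)]
        omega
      · have a2 := hconst c (by omega) (by omega)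
        rw [if_neg (by omega), if_pos h', if_pos (by omega)]
        rcases hww with h | h
        · subst h
          omega
        · omega
      · rw [if_pos h', if_neg (by omega), if_pos (by omega)]
        rcases hww with h | h
        · subst h
          omega
        · omega

/-! ### The infinite-capacity carrier -/

theorem infOut_zero (x : Multiset ℕ) : infOut x 0 = x.sup := by
  simp [infOut]

theorem infOut_of_ne_zero (x : Multiset ℕ) {y : ℕ} (hy : y ≠ 0) :
    infOut x y = (x.filter (· < y)).sup := by
  simp only [infOut, hy, if_false]

theorem infStep_zero (x : Multiset ℕ) : infStep x 0 = x.erase (infOut x 0) := by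
  simp only [infStep, infOut_zero, if_true]

theorem infStep_of_ne_zero (x : Multiset ℕ) {y : ℕ} (hy : y ≠ 0) :
    infStep x y = y ::ₘ x.erase (infOut x y) := by
  simp only [infStep, infOut, hy, if_false]

theorem Multiset.sup_mem_or_eq_zero (x : Multiset ℕ) : x.sup = 0 ∨ x.sup ∈ x := by
  induction x using Multiset.induction_on with
  | empty => simp
  | cons a x ih =>
    rw [Multiset.sup_cons]
    rcases le_total a x.sup with h | h
    · rw [sup_eq_right.2 h]
      exact ih.imp_right fun h => Multiset.mem_cons_of_mem h
    · rw [sup_eq_left.2 h]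
      exact Or.inr (Multiset.mem_cons_self _ _)

theorem infOut_eq_zero_or_mem (x : Multiset ℕ) (y : ℕ) : infOut x y = 0 ∨ infOut x y ∈ x := by
  by_cases hy : y = 0
  · subst hy
    rw [infOut_zero]
    exact x.sup_mem_or_eq_zero
  · rw [infOut_of_ne_zero x hy]
    exact (Multiset.sup_mem_or_eq_zero _).imp_right fun h => Multiset.mem_of_mem_filter h

theorem infOut_lt (x : Multiset ℕ) {y : ℕ} (hy : y ≠ 0) : infOut x y < y := by
  rw [infOut_of_ne_zero x hy]
  rcases Multiset.sup_mem_or_eq_zero (x.filter (· < y)) with h | h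
  · omega
  · exact (Multiset.mem_filter.1 h).2

theorem le_infOut {x : Multiset ℕ} {a y : ℕ} (ha : a ∈ x) (hy : y = 0 ∨ a < y) :
    a ≤ infOut x y := by
  rcases hy with rfl | hy
  · rw [infOut_zero]
    exact Multiset.le_sup ha
  · rw [infOut_of_ne_zero x (by omega)]
    exact Multiset.le_sup (Multiset.mem_filter.2 ⟨ha, hy⟩)

theorem zero_notMem_infCarrier (X : ℕ → ℕ) (t : ℕ) : 0 ∉ infCarrier X t := by
  induction t with
  | zero => simp [infCarrier]
  | succ t ih =>
    rw [infCarrier]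
    by_cases hy : X t = 0
    · rw [hy, infStep_zero]
      exact fun h => ih (Multiset.mem_of_mem_erase h)
    · rw [infStep_of_ne_zero _ hy, Multiset.mem_cons, not_or]
      exact ⟨fun h => hy h.symm, fun h => ih (Multiset.mem_of_mem_erase h)⟩

theorem lt_of_mem_infCarrier {X : ℕ → ℕ} {N : ℕ} (h : ∀ s, X s < N) {t a : ℕ}
    (ha : a ∈ infCarrier X t) : a < N := by
  induction t with
  | zero => simp [infCarrier] at ha
  | succ t ih =>
    rw [infCarrier] at ha
    by_cases hy : X t = 0
    · rw [hy, infStep_zero] at ha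
      exact ih (Multiset.mem_of_mem_erase ha)
    · rw [infStep_of_ne_zero _ hy, Multiset.mem_cons] at ha
      rcases ha with rfl | ha
      · exact h t
      · exact ih (Multiset.mem_of_mem_erase ha)

theorem bbsStep_lt {X : ℕ → ℕ} {N : ℕ} (h : ∀ s, X s < N) (s : ℕ) : bbsStep X s < N := by
  rcases infOut_eq_zero_or_mem (infCarrier X s) (X s) with h0 | h0
  · have := h s
    rw [bbsStep, h0]
    omega
  · exact lt_of_mem_infCarrier h h0

/-- Ejecting a ball removes one ball from a carrier unless an empty slot is ejected. -/
theorem card_erase_infOut {x : Multiset ℕ} (hx : 0 ∉ x) (y : ℕ) :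
    (x.erase (infOut x y)).card + (if 0 < infOut x y then 1 else 0) = x.card := by
  rcases infOut_eq_zero_or_mem x y with h | h
  · rw [h, Multiset.erase_of_notMem hx]
    simp
  · rw [if_pos (Nat.pos_of_ne_zero fun h0 => hx (h0 ▸ h)), Multiset.card_erase_add_one h]

theorem card_infStep {x : Multiset ℕ} (hx : 0 ∉ x) (y : ℕ) :
    (infStep x y).card + (if 0 < infOut x y then 1 else 0) =
      x.card + if 0 < y then 1 else 0 := by
  have h := card_erase_infOut hx y
  by_cases hy : y = 0
  · subst hy
    rw [infStep_zero]
    simpa using h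
  · rw [infStep_of_ne_zero x hy, Multiset.card_cons, if_pos (Nat.pos_of_ne_zero hy)]
    omega

theorem infOut_zero_pos {x : Multiset ℕ} (hx : 0 ∉ x) (h : x ≠ 0) : 0 < infOut x 0 := by
  obtain ⟨a, ha⟩ := Multiset.exists_mem_of_ne_zero h
  have := le_infOut ha (Or.inl rfl)
  have : a ≠ 0 := fun h0 => hx (h0 ▸ ha)
  omega

theorem card_infStep_zero {x : Multiset ℕ} (hx : 0 ∉ x) :
    (infStep x 0).card = x.card - 1 := by
  have h := card_infStep hx 0
  by_cases hx0 : x = 0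
  · subst hx0
    simp at h
    simp [h]
  · rw [if_pos (infOut_zero_pos hx hx0)] at h
    simp at h
    omega

theorem card_infCarrier_add {X : ℕ → ℕ} {t : ℕ} (j : ℕ)
    (h : ∀ s, t ≤ s → s < t + j → X s = 0) :
    (infCarrier X (t + j)).card = (infCarrier X t).card - j := by
  induction j with
  | zero => simp
  | succ j ih =>
    rw [← add_assoc, infCarrier, h (t + j) (by omega) (by omega),
      card_infStep_zero (zero_notMem_infCarrier X _), ih fun s h1 h2 => h s h1 (by omega)]
    omega

theorem infCarrier_eq_zero {X : ℕ → ℕ} {t s : ℕ}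
    (h : ∀ u, t ≤ u → u < s → X u = 0) (hs : t + (infCarrier X t).card ≤ s) :
    infCarrier X s = 0 := by
  obtain ⟨j, rfl⟩ := Nat.exists_eq_add_of_le (show t ≤ s by omega)
  rw [← Multiset.card_eq_zero, card_infCarrier_add j h]
  omega

theorem infCarrier_eventually_eq_zero {X : ℕ → ℕ} {n : ℕ} (h : ∀ s, n ≤ s → X s = 0) :
    ∃ t, ∀ s, t ≤ s → infCarrier X s = 0 :=
  ⟨n + (infCarrier X n).card, fun _ hs => infCarrier_eq_zero (fun u hu _ => h u hu) hs⟩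

theorem bbsStep_finite {X : ℕ → ℕ} {n : ℕ} (h : ∀ s, n ≤ s → X s = 0) :
    ∃ t, ∀ s, t ≤ s → bbsStep X s = 0 := by
  obtain ⟨t, ht⟩ := infCarrier_eventually_eq_zero h
  refine ⟨max t n, fun s hs => ?_⟩
  rw [bbsStep, ht s (le_of_max_le_left hs), h s (le_of_max_le_right hs), infOut_zero]
  simp

theorem profile_eq_transfer (k : ℕ) {X : ℕ → ℕ} {N : ℕ} (hN : ∀ s, X s < N) (t : ℕ) :
    profile k (vacuum k) X t 0 =
        transfer (profile k (vacuum k) (bbsStep X) t) (infCarrier X t) N ∧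
      ∀ c, 1 ≤ c → c ≤ N → profile k (vacuum k) X t c =
        k + transfer (profile k (vacuum k) (bbsStep X) t) (infCarrier X t) c := by
  have hN0 : 1 ≤ N := by have := hN 0; omega
  induction t with
  | zero =>
    simp only [profile, infCarrier, transfer_zero_right (isProfile_vacuum k).mono]
    refine ⟨trivial, fun c hc _ => ?_⟩
    simp [vacuum, show c ≠ 0 by omega]
  | succ t ih =>
    obtain ⟨ih0, ih1⟩ := ih
    have hV := (isProfile_vacuum k).profile (bbsStep X) t
    set V := profile k (vacuum k) (bbsStep X) t
    set z := infCarrier X t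
    have hz0 : 0 ∉ z := zero_notMem_infCarrier X t
    have hb : bbsStep X t = infOut z (X t) := rfl
    have hmem := infOut_eq_zero_or_mem z (X t)
    simp only [profile, infCarrier]
    rw [hb]
    by_cases hy : X t = 0
    · rw [hy] at hmem ⊢
      have hlt : infOut z 0 < N := by
        have := bbsStep_lt hN t
        rwa [hb, hy] at this
      have core := fun c hc => transfer_profStep (c := c) hV hz0 hlt hmem
        (fun a ha _ => le_infOut ha (Or.inl rfl)) hc
      have hcongr : ∀ c, c ≤ N → transfer (profStep k V (infOut z 0)) (infStep z 0) c =
          transfer (profStep k V (infOut z 0)) (N ::ₘ z.erase (infOut z 0)) c := by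
        intro c hc
        refine transfer_congr fun d hd => ?_
        rw [infStep_zero, Multiset.count_cons_of_ne (by omega)]
      refine ⟨?_, fun c hc hcN => ?_⟩
      · rw [hcongr N le_rfl, core N hN0]
        simp [profStep, ih0]
      · rw [hcongr c hcN, core c hc]
        simp only [profStep, ih0, ih1 c hc hcN]
        rw [if_pos (by omega), if_neg (by omega)]
        omega
    · rw [infStep_of_ne_zero z hy]
      have core := fun c hc => transfer_profStep (c := c) hV hz0 (infOut_lt z hy) hmem
        (fun a ha hay => le_infOut ha (Or.inr hay)) hc
      have hyN := hN t
      refine ⟨?_, fun c hc hcN => ?_⟩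
      · rw [core N hN0]
        simp only [profStep, ih0, ih1 (X t) (by omega) hyN.le]
        rw [if_neg (by omega), if_pos hyN]
        omega
      · rw [core c hc]
        simp only [profStep, ih1 c hc hcN, ih1 (X t) (by omega) hyN.le]
        omega

/-- The energy is invariant under the box-ball dynamics. -/
theorem energy_bbsStep (k : ℕ) {X : ℕ → ℕ} {N n : ℕ} (hN : ∀ s, X s < N)
    (hn : ∀ s, n ≤ s → X s = 0) :
    ∃ T, ∀ t, T ≤ t → energy k X t = energy k (bbsStep X) t := by
  obtain ⟨T, hT⟩ := infCarrier_eventually_eq_zero hn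
  refine ⟨T, fun t ht => ?_⟩
  have h := (profile_eq_transfer k hN t).1
  rwa [hT t ht, transfer_zero_right ((isProfile_vacuum k).profile _ t).mono] at h

theorem iterate_bbsStep_lt {X : ℕ → ℕ} {N : ℕ} (h : ∀ s, X s < N) (τ s : ℕ) :
    bbsStep^[τ] X s < N := by
  induction τ generalizing s with
  | zero => exact h s
  | succ τ ih =>
    rw [Function.iterate_succ_apply']
    exact bbsStep_lt ih s

theorem iterate_bbsStep_finite {X : ℕ → ℕ} {n : ℕ} (h : ∀ s, n ≤ s → X s = 0) (τ : ℕ) :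
    ∃ t, ∀ s, t ≤ s → bbsStep^[τ] X s = 0 := by
  induction τ with
  | zero => exact ⟨n, h⟩
  | succ τ ih =>
    obtain ⟨t, ht⟩ := ih
    simp only [Function.iterate_succ_apply']
    exact bbsStep_finite ht

theorem energy_iterate_bbsStep (k : ℕ) {X : ℕ → ℕ} {N n : ℕ} (hN : ∀ s, X s < N)
    (hn : ∀ s, n ≤ s → X s = 0) (τ : ℕ) :
    ∃ T, ∀ t, T ≤ t → energy k (bbsStep^[τ] X) t = energy k X n := by
  induction τ with
  | zero => exact ⟨n, fun t ht => energy_eq_of_le hn ht⟩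
  | succ τ ih =>
    obtain ⟨T, hT⟩ := ih
    obtain ⟨n', hn'⟩ := iterate_bbsStep_finite hn τ
    obtain ⟨T', hT'⟩ := energy_bbsStep k (iterate_bbsStep_lt hN τ) hn'
    refine ⟨max T T', fun t ht => ?_⟩
    rw [Function.iterate_succ_apply', ← hT' t (le_of_max_le_right ht),
      hT t (le_of_max_le_left ht)]

/-! ### Runs of a configuration and their evolution -/

/-- The maximal nonincreasing runs of `Y` are `[a i, b i)` for `i < m`, from left to right. -/
structure IsRunDecomp (Y : ℕ → ℕ) (m : ℕ) (a b : ℕ → ℕ) : Prop where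
  lt : ∀ i, i < m → a i < b i
  le : ∀ i, i + 1 < m → b i ≤ a (i + 1)
  pos_iff : ∀ s, 0 < Y s ↔ ∃ i, i < m ∧ a i ≤ s ∧ s < b i
  anti : ∀ i, i < m → ∀ s, a i ≤ s → s + 1 < b i → Y (s + 1) ≤ Y s
  asc : ∀ i, i + 1 < m → b i = a (i + 1) → Y (b i - 1) < Y (b i)

namespace IsRunDecomp

variable {Y : ℕ → ℕ} {m : ℕ} {a b : ℕ → ℕ}

theorem le_of_lt (h : IsRunDecomp Y m a b) {i j : ℕ} (hij : i < j) (hj : j < m) : b i ≤ a j := by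
  induction j, (show i + 1 ≤ j from hij) using Nat.le_induction with
  | base => exact h.le i hj
  | succ j hj' ih =>
    have h1 := ih (by omega) (by omega)
    have h2 := h.lt j (by omega)
    have h3 := h.le j hj
    omega

theorem end_lt (h : IsRunDecomp Y m a b) {i j : ℕ} (hij : i < j) (hj : j < m) : b i < b j :=
  (h.le_of_lt hij hj).trans_lt (h.lt j hj)

theorem end_le (h : IsRunDecomp Y m a b) {i j : ℕ} (hij : i ≤ j) (hj : j < m) : b i ≤ b j := by
  rcases hij.lt_or_eq with hij | rfl
  · exact (h.end_lt hij hj).le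
  · exact le_rfl

theorem start_lt (h : IsRunDecomp Y m a b) {i j : ℕ} (hij : i < j) (hj : j < m) : a i < a j :=
  (h.lt i (by omega)).trans_le (h.le_of_lt hij hj)

theorem index_unique (h : IsRunDecomp Y m a b) {i j s : ℕ} (hi : i < m) (hj : j < m)
    (h1 : a i ≤ s) (h2 : s < b i) (h3 : a j ≤ s) (h4 : s < b j) : i = j := by
  rcases lt_trichotomy i j with hij | hij | hij
  · have := h.le_of_lt hij hj
    omega
  · exact hij
  · have := h.le_of_lt hij hi
    omega

theorem start_eq_of_end_pos (h : IsRunDecomp Y m a b) {i : ℕ} (hi : i < m) (hpos : 0 < Y (b i)) :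
    i + 1 < m ∧ b i = a (i + 1) := by
  obtain ⟨j, hj, h1, h2⟩ := (h.pos_iff _).1 hpos
  have hij : i < j := by
    by_contra hij
    have := h.end_le (not_lt.1 hij) hi
    omega
  have h3 := h.le i (by omega)
  refine ⟨by omega, le_antisymm h3 ?_⟩
  rcases (show i + 1 ≤ j from hij).lt_or_eq with hlt | rfl
  · have := h.start_lt hlt hj
    omega
  · exact h1

theorem end_eq_zero_or_lt (h : IsRunDecomp Y m a b) {i : ℕ} (hi : i < m) :
    Y (b i) = 0 ∨ Y (b i - 1) < Y (b i) := by
  rcases Nat.eq_zero_or_pos (Y (b i)) with h0 | h0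
  · exact Or.inl h0
  · obtain ⟨h1, h2⟩ := h.start_eq_of_end_pos hi h0
    exact Or.inr (h.asc i h1 h2)

theorem anti_of_le (h : IsRunDecomp Y m a b) {i : ℕ} (hi : i < m) {s t : ℕ} (hs : a i ≤ s)
    (hst : s ≤ t) (ht : t < b i) : Y t ≤ Y s := by
  induction t, hst using Nat.le_induction with
  | base => exact le_rfl
  | succ t hst ih => exact (h.anti i hi t (by omega) ht).trans (ih (by omega))

theorem isMaxRun_iff (h : IsRunDecomp Y m a b) (s n : ℕ) :
    IsMaxRun Y s n ↔ ∃ i, i < m ∧ s = a i ∧ s + n = b i := by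
  constructor
  · rintro ⟨hn, hpos, hanti, hl, hr⟩
    obtain ⟨i, hi, h1, h2⟩ := (h.pos_iff s).1 (hpos 0 hn)
    have hs : s = a i := by
      by_contra hne
      obtain ⟨t, rfl⟩ := Nat.exists_eq_succ_of_ne_zero (show s ≠ 0 by omega)
      have h3 := h.anti i hi t (by omega) h2
      have h4 := (h.pos_iff t).2 ⟨i, hi, by omega, by omega⟩
      rcases hl t rfl with h5 | h5
      · omega
      · simp only [Nat.succ_eq_add_one] at h5
        omega
    refine ⟨i, hi, hs, ?_⟩
    rcases lt_trichotomy (s + n) (b i) with hlt | heq | hgt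
    · have h3 := (h.pos_iff (s + n)).2 ⟨i, hi, by omega, hlt⟩
      have h4 := h.anti_of_le hi (s := s + (n - 1)) (by omega) (by omega) hlt
      omega
    · exact heq
    · obtain ⟨j, hj⟩ := Nat.exists_eq_add_of_le h2.le
      have h3 := hpos j (by omega)
      have h4 := hanti (j - 1) j (by omega) (by omega)
      rw [← hj] at h3 h4
      have h5 := h.end_eq_zero_or_lt hi
      rw [show b i - 1 = s + (j - 1) by omega] at h5
      omega
  · rintro ⟨i, hi, rfl, hn⟩
    have hlt := h.lt i hi
    refine ⟨by omega, fun j hj => (h.pos_iff _).2 ⟨i, hi, by omega, by omega⟩,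
      fun j j' hjj' hj' => h.anti_of_le hi (by omega) (by omega) (by omega), ?_, ?_⟩
    · intro t ht
      rcases Nat.eq_zero_or_pos (Y t) with h0 | h0
      · exact Or.inl h0
      · obtain ⟨j, hj, h1, h2⟩ := (h.pos_iff t).1 h0
        have hb : b j = t + 1 := by
          by_contra hne
          have := h.index_unique (s := t + 1) hi hj (by omega) (by omega) (by omega) (by omega)
          subst this
          omega
        have h3 := h.end_eq_zero_or_lt hj
        have h4 := (h.pos_iff (a i)).2 ⟨i, hi, le_rfl, hlt⟩
        rw [hb, ht, show a i - 1 = t by omega] at h3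
        omega
    · rw [hn, show a i + (n - 1) = b i - 1 by omega]
      exact h.end_eq_zero_or_lt hi

theorem rowLen_eq (h : IsRunDecomp Y m a b) (k : ℕ) :
    rowLen k Y = ((Finset.range m).filter fun i => k ≤ b i - a i).card := by
  have hset : {s | ∃ n, k ≤ n ∧ IsMaxRun Y s n} =
      a '' ((Finset.range m).filter fun i => k ≤ b i - a i : Finset ℕ) := by
    ext s
    simp only [h.isMaxRun_iff, Set.mem_ofPred_eq, Set.mem_image, Finset.mem_coe, Finset.mem_filter,
      Finset.mem_range]
    constructor
    · rintro ⟨n, hn, i, hi, rfl, hb⟩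
      exact ⟨i, ⟨hi, by omega⟩, rfl⟩
    · rintro ⟨i, ⟨hi, hk⟩, rfl⟩
      exact ⟨b i - a i, hk, i, hi, rfl, by have := h.lt i hi; omega⟩
  rw [rowLen, hset, Set.InjOn.ncard_image, Set.ncard_coe_finset]
  intro i hi j hj hij
  simp only [Finset.mem_coe, Finset.mem_filter, Finset.mem_range] at hi hj
  rcases lt_trichotomy i j with hlt | heq | hgt
  · have := h.start_lt hlt hj.1
    omega
  · exact heq
  · have := h.start_lt hgt hi.1
    omega

end IsRunDecomp

theorem exists_isRunDecomp (n : ℕ) (Y : ℕ → ℕ) (hY : ∀ s, n ≤ s → Y s = 0) :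
    ∃ m a b, IsRunDecomp Y m a b ∧ ∀ i, i < m → b i ≤ n := by
  induction n generalizing Y with
  | zero =>
    refine ⟨0, id, id, ⟨by simp, by simp, fun s => ?_, by simp, by simp⟩, by simp⟩
    simp [hY s (Nat.zero_le s)]
  | succ n ih =>
    obtain ⟨m, a, b, h, hb⟩ := ih (fun s => if s < n then Y s else 0) fun s hs => by simp; omega
    have hpos : ∀ s, s < n → (0 < Y s ↔ ∃ i, i < m ∧ a i ≤ s ∧ s < b i) := by
      intro s hs
      have := h.pos_iff s
      rwa [if_pos hs] at this
    have hanti : ∀ i, i < m → ∀ s, a i ≤ s → s + 1 < b i → Y (s + 1) ≤ Y s := by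
      intro i hi s h1 h2
      have h3 := h.anti i hi s h1 h2
      have := hb i hi
      rwa [if_pos (by omega), if_pos (by omega)] at h3
    have hasc : ∀ i, i + 1 < m → b i = a (i + 1) → Y (b i - 1) < Y (b i) := by
      intro i hi h1
      have h2 := h.asc i hi h1
      have h3 := hb (i + 1) hi
      have h4 := h.lt (i + 1) hi
      have h5 := h.lt i (by omega)
      rwa [if_pos (by omega), if_pos (by omega)] at h2
    by_cases hn : Y n = 0
    · refine ⟨m, a, b, ⟨h.lt, h.le, fun s => ?_, hanti, hasc⟩,
        fun i hi => (hb i hi).trans (Nat.le_succ n)⟩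
      rcases lt_trichotomy s n with hs | rfl | hs
      · exact hpos s hs
      · simp only [hn, lt_self_iff_false, false_iff, not_exists, not_and, not_lt]
        exact fun i hi _ => hb i hi
      · simp only [hY s hs, lt_self_iff_false, false_iff, not_exists, not_and, not_lt]
        exact fun i hi _ => (hb i hi).trans hs.le
    · by_cases hm : ∃ l, m = l + 1 ∧ b l = n ∧ Y n ≤ Y (n - 1)
      · obtain ⟨l, rfl, hl, hle⟩ := hm
        have hal := h.lt l (by omega)
        have hb' : ∀ i, Function.update b l (n + 1) i = if i = l then n + 1 else b i := by
          intro i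
          simp [Function.update_apply]
        refine ⟨l + 1, a, Function.update b l (n + 1), ⟨?_, ?_, ?_, ?_, ?_⟩, ?_⟩
        · intro i hi
          have := h.lt i hi
          rw [hb']
          split_ifs with hil
          · subst hil
            omega
          · exact this
        · intro i hi
          rw [hb', if_neg (by omega)]
          exact h.le i hi
        · intro s
          rcases lt_trichotomy s n with hs | rfl | hs
          · rw [hpos s hs]
            refine exists_congr fun i => and_congr_right fun hi => and_congr_right fun _ => ?_
            rw [hb']
            split_ifs with hil
            · subst hil
              omega
            · rfl
          · refine iff_of_true (Nat.pos_of_ne_zero hn) ⟨l, by omega, by omega, ?_⟩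
            rw [hb', if_pos rfl]
            omega
          · rw [hY s hs]
            refine iff_of_false (lt_irrefl 0) ?_
            rintro ⟨i, hi, -, h2⟩
            have := hb i hi
            rw [hb'] at h2
            split_ifs at h2 <;> omega
        · intro i hi s h1 h2
          rw [hb'] at h2
          split_ifs at h2 with hil
          · subst hil
            rcases Nat.lt_or_ge (s + 1) n with h3 | h3
            · exact hanti i hi s h1 (by omega)
            · rw [show s + 1 = n by omega, show s = n - 1 by omega]
              exact hle
          · exact hanti i hi s h1 h2
        · intro i hi h1
          rw [hb', if_neg (by omega)] at h1 ⊢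
          exact hasc i hi h1
        · intro i hi
          have := hb i hi
          rw [hb']
          split_ifs <;> omega
      · have ha' : ∀ i, Function.update a m n i = if i = m then n else a i := by
          intro i
          simp [Function.update_apply]
        have hb' : ∀ i, Function.update b m (n + 1) i = if i = m then n + 1 else b i := by
          intro i
          simp [Function.update_apply]
        refine ⟨m + 1, Function.update a m n, Function.update b m (n + 1),
          ⟨?_, ?_, ?_, ?_, ?_⟩, ?_⟩
        · intro i hi
          rw [ha', hb']
          split_ifs with him
          · omega
          · exact h.lt i (by omega)
        · intro i hi
          rw [ha', hb', if_neg (by omega)]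
          split_ifs with him
          · exact hb i (by omega)
          · exact h.le i (by omega)
        · intro s
          simp only [ha', hb']
          rcases lt_trichotomy s n with hs | rfl | hs
          · rw [hpos s hs]
            constructor
            · rintro ⟨i, hi, h1, h2⟩
              refine ⟨i, by omega, ?_⟩
              rw [if_neg (by omega), if_neg (by omega)]
              exact ⟨h1, h2⟩
            · rintro ⟨i, hi, h1, h2⟩
              split_ifs at h1 h2 with him
              · omega
              · exact ⟨i, by omega, h1, h2⟩
          · refine iff_of_true (Nat.pos_of_ne_zero hn) ⟨m, by omega, ?_⟩
            simp
          · rw [hY s hs]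
            refine iff_of_false (lt_irrefl 0) ?_
            rintro ⟨i, hi, -, h2⟩
            split_ifs at h2 with him
            · omega
            · have := hb i (by omega)
              omega
        · intro i hi s h1 h2
          rw [ha'] at h1
          rw [hb'] at h2
          split_ifs at h1 h2 with him
          · omega
          · exact hanti i (by omega) s h1 h2
        · intro i hi h1
          rw [ha', hb', if_neg (by omega)] at h1
          rw [hb', if_neg (by omega)]
          split_ifs at h1 with him
          · by_contra hlt
            refine hm ⟨i, by omega, h1, ?_⟩
            rw [h1] at hlt
            omega
          · exact hasc i (by omega) h1
        · intro i hi
          rw [hb']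
          split_ifs with him
          · exact le_rfl
          · exact (hb i (by omega)).trans (Nat.le_succ n)

/-- The number of balls of `Y` among the first `t` boxes. -/
def ballCount (Y : ℕ → ℕ) (t : ℕ) : ℕ := ((Finset.range t).filter fun s => 0 < Y s).card

theorem ballCount_succ (Y : ℕ → ℕ) (t : ℕ) :
    ballCount Y (t + 1) = ballCount Y t + if 0 < Y t then 1 else 0 := by
  rw [ballCount, ballCount, Finset.range_add_one, Finset.filter_insert]
  split_ifs
  · rw [Finset.card_insert_of_notMem (by simp)]
  · simp

theorem card_infCarrier_add_ballCount (X : ℕ → ℕ) (t : ℕ) :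
    (infCarrier X t).card + ballCount (bbsStep X) t = ballCount X t := by
  induction t with
  | zero => simp [infCarrier, ballCount]
  | succ t ih =>
    have h := card_infStep (zero_notMem_infCarrier X t) (X t)
    rw [ballCount_succ, ballCount_succ, infCarrier, bbsStep]
    omega

theorem bbsStep_succ_le {X : ℕ → ℕ} {s : ℕ}
    (h : X s = 0 ∨ (0 < X (s + 1) ∧ X (s + 1) ≤ X s)) : bbsStep X (s + 1) ≤ bbsStep X s := by
  rw [bbsStep, bbsStep, infCarrier]
  set z := infCarrier X s
  rcases infOut_eq_zero_or_mem (infStep z (X s)) (X (s + 1)) with h0 | h0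
  · rw [h0]
    exact Nat.zero_le _
  · rcases h with h | ⟨hpos, hle⟩
    · rw [h, infStep_zero] at h0 ⊢
      exact le_infOut (Multiset.mem_of_mem_erase h0) (Or.inl rfl)
    · have hlt := infOut_lt (infStep z (X s)) hpos.ne'
      generalize infOut (infStep z (X s)) (X (s + 1)) = w at h0 hlt
      rw [infStep_of_ne_zero z (by omega), Multiset.mem_cons] at h0
      rcases h0 with h0 | h0
      · omega
      · exact le_infOut (Multiset.mem_of_mem_erase h0) (Or.inr (by omega))

theorem bbsStep_lt_succ {X : ℕ → ℕ} {s : ℕ} (hpos : 0 < X s)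
    (h : X (s + 1) = 0 ∨ X s < X (s + 1)) : bbsStep X s < bbsStep X (s + 1) := by
  refine (infOut_lt (infCarrier X s) hpos.ne').trans_le (le_infOut ?_ h)
  rw [infCarrier, infStep_of_ne_zero _ hpos.ne']
  exact Multiset.mem_cons_self _ _

theorem bbsStep_apply_zero (X : ℕ → ℕ) : bbsStep X 0 = 0 := by
  rcases infOut_eq_zero_or_mem (infCarrier X 0) (X 0) with h | h
  · exact h
  · simp [infCarrier] at h

/-- The total length of the first `i` runs. -/
def lenSum (a b : ℕ → ℕ) (i : ℕ) : ℕ := ∑ j ∈ Finset.range i, (b j - a j)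

namespace IsRunDecomp

variable {Y : ℕ → ℕ} {m : ℕ} {a b : ℕ → ℕ}

theorem ballCount_eq (h : IsRunDecomp Y m a b) {i t : ℕ} (hi : i ≤ m) (h1 : ∀ j, j < i → b j ≤ t)
    (h2 : ∀ j, i ≤ j → j < m → t ≤ a j) : ballCount Y t = lenSum a b i := by
  have hset : ((Finset.range t).filter fun s => 0 < Y s) =
      (Finset.range i).biUnion fun j => Finset.Ico (a j) (b j) := by
    ext s
    simp only [Finset.mem_filter, Finset.mem_range, h.pos_iff, Finset.mem_biUnion, Finset.mem_Ico]
    constructor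
    · rintro ⟨hs, j, hj, h3, h4⟩
      refine ⟨j, ?_, h3, h4⟩
      by_contra hij
      have := h2 j (not_lt.1 hij) hj
      omega
    · rintro ⟨j, hj, h3, h4⟩
      exact ⟨h4.trans_le (h1 j hj), j, by omega, h3, h4⟩
  rw [ballCount, hset, Finset.card_biUnion]
  · simp [lenSum]
  · intro j hj l hl hjl
    rw [Finset.mem_coe, Finset.mem_range] at hj hl
    rw [Function.onFun, Finset.disjoint_left]
    intro s hs hs'
    rw [Finset.mem_Ico] at hs hs'
    exact hjl (h.index_unique (by omega) (by omega) hs.1 hs.2 hs'.1 hs'.2)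

theorem eq_zero_of_le (h : IsRunDecomp Y m a b) {s : ℕ} (hs : ∀ j, j < m → b j ≤ s) :
    Y s = 0 := by
  by_contra h0
  obtain ⟨j, hj, -, h2⟩ := (h.pos_iff s).1 (Nat.pos_of_ne_zero h0)
  have := hs j hj
  omega

/-- Under the box-ball dynamics every run moves to where it ended. -/
theorem exists_bbsStep (h : IsRunDecomp Y m a b) : ∃ b', IsRunDecomp (bbsStep Y) m b b' := by
  have hasc : ∀ i, i < m → bbsStep Y (b i - 1) < bbsStep Y (b i) := by
    intro i hi
    have hlt := h.lt i hi
    obtain ⟨s, hs⟩ := Nat.exists_eq_succ_of_ne_zero (show b i ≠ 0 by omega)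
    have hz := h.end_eq_zero_or_lt hi
    have hpos := (h.pos_iff s).2 ⟨i, hi, by omega, by omega⟩
    rw [hs] at hz ⊢
    exact bbsStep_lt_succ hpos hz
  have hdesc : ∀ s, (∀ i, i < m → b i ≠ s + 1) → bbsStep Y (s + 1) ≤ bbsStep Y s := by
    intro s hs
    refine bbsStep_succ_le ?_
    rcases Nat.eq_zero_or_pos (Y s) with h0 | h0
    · exact Or.inl h0
    · obtain ⟨i, hi, h1, h2⟩ := (h.pos_iff s).1 h0
      have := hs i hi
      exact Or.inr ⟨(h.pos_iff _).2 ⟨i, hi, by omega, by omega⟩, h.anti i hi s h1 (by omega)⟩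
  obtain ⟨T, hT⟩ : ∃ T, ∀ s, T ≤ s → bbsStep Y s = 0 := by
    cases m with
    | zero => exact bbsStep_finite (n := 0) fun s _ => h.eq_zero_of_le (by simp)
    | succ l =>
      exact bbsStep_finite (n := b l) fun s hs =>
        h.eq_zero_of_le fun j hj => (h.end_le (Nat.le_of_lt_succ hj) (by omega)).trans hs
  have hex : ∀ i, ∃ s, b i < s ∧ (bbsStep Y s = 0 ∨ (i + 1 < m ∧ s = b (i + 1))) := fun i =>
    ⟨max T (b i + 1), by omega, Or.inl (hT _ (le_max_left _ _))⟩
  classical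
  have hle : ∀ i, i + 1 < m → Nat.find (hex i) ≤ b (i + 1) := fun i hi =>
    Nat.find_min' (hex i) ⟨h.end_lt (Nat.lt_succ_self i) hi, Or.inr ⟨hi, rfl⟩⟩
  refine ⟨fun i => Nat.find (hex i), fun i _ => (Nat.find_spec (hex i)).1, hle, ?_, ?_, ?_⟩
  · intro s
    constructor
    · induction s with
      | zero =>
        intro h0
        rw [bbsStep_apply_zero] at h0
        omega
      | succ s ih =>
        intro h0
        by_cases hb : ∃ i, i < m ∧ b i = s + 1
        · obtain ⟨i, hi, hb⟩ := hb
          refine ⟨i, hi, hb.le, ?_⟩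
          rw [← hb]
          exact (Nat.find_spec (hex i)).1
        · have hb' : ∀ i, i < m → b i ≠ s + 1 := fun i hi h' => hb ⟨i, hi, h'⟩
          obtain ⟨i, hi, h1, h2⟩ := ih (h0.trans_le (hdesc s hb'))
          refine ⟨i, hi, by omega, lt_of_le_of_ne h2 ?_⟩
          intro heq
          rcases (Nat.find_spec (hex i)).2 with h3 | ⟨h3, h4⟩
          · rw [← heq] at h3
            omega
          · exact hb' (i + 1) h3 (by rw [← h4]; exact heq.symm)
    · rintro ⟨i, hi, h1, h2⟩
      rcases h1.lt_or_eq with h1 | rfl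
      · have h3 := Nat.find_min (hex i) h2
        by_contra h0
        exact h3 ⟨h1, Or.inl (by omega)⟩
      · exact (Nat.zero_le _).trans_lt (hasc i hi)
  · intro i hi s h1 h2
    refine hdesc s fun j hj hb => ?_
    rcases lt_or_ge i j with hij | hij
    · have h3 := hle i (by omega)
      have h4 := h.end_le (show i + 1 ≤ j from hij) hj
      omega
    · have := h.end_le hij hi
      omega
  · intro i hi heq
    rw [heq]
    exact hasc (i + 1) hi

theorem le_countP_infCarrier (h : IsRunDecomp Y m a b) {i : ℕ} (hi : i < m) (j : ℕ)
    (hj : a i + j < b i) :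
    j + 1 ≤ (infCarrier Y (a i + j + 1)).countP (Y (a i + j) ≤ ·) := by
  have hstep : ∀ s, 0 < Y s → (infCarrier Y (s + 1)).countP (Y s ≤ ·) =
      (infCarrier Y s).countP (Y s ≤ ·) + 1 := by
    intro s hs
    have hlt := infOut_lt (infCarrier Y s) hs.ne'
    rw [infCarrier, infStep_of_ne_zero _ hs.ne', Multiset.countP_cons_of_pos _ le_rfl]
    rcases infOut_eq_zero_or_mem (infCarrier Y s) (Y s) with h0 | h0
    · rw [h0, Multiset.erase_of_notMem (zero_notMem_infCarrier Y s)]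
    · conv_rhs => rw [← Multiset.cons_erase h0, Multiset.countP_cons_of_neg _ (not_le.2 hlt)]
  rw [hstep _ ((h.pos_iff _).2 ⟨i, hi, by omega, hj⟩)]
  induction j with
  | zero => exact Nat.succ_le_succ (Nat.zero_le _)
  | succ j ih =>
    have h1 := ih (by omega)
    rw [← hstep _ ((h.pos_iff _).2 ⟨i, hi, by omega, by omega⟩)] at h1
    refine Nat.succ_le_succ (h1.trans ?_)
    rw [← add_assoc, Multiset.countP_eq_card_filter, Multiset.countP_eq_card_filter]
    exact Multiset.card_le_card (Multiset.monotone_filter_right _ fun x hx =>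
      (h.anti i hi (a i + j) (by omega) hj).trans hx)

theorem len_le_card_infCarrier (h : IsRunDecomp Y m a b) {i : ℕ} (hi : i < m) :
    b i - a i ≤ (infCarrier Y (b i)).card := by
  have hlt := h.lt i hi
  have := h.le_countP_infCarrier hi (b i - a i - 1) (by omega)
  rw [show a i + (b i - a i - 1) + 1 = b i by omega] at this
  have := Multiset.countP_le_card (Y (a i + (b i - a i - 1)) ≤ ·) (infCarrier Y (b i))
  omega

theorem card_infCarrier_add_lenSum {b' : ℕ → ℕ} (h : IsRunDecomp Y m a b)
    (h' : IsRunDecomp (bbsStep Y) m b b') {i : ℕ} (hi : i < m) :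
    (infCarrier Y (b i)).card + lenSum b b' i = lenSum a b i + (b i - a i) := by
  have h1 := card_infCarrier_add_ballCount Y (b i)
  have h2 : ballCount (bbsStep Y) (b i) = lenSum b b' i :=
    h'.ballCount_eq hi.le (fun j hj => h'.le_of_lt hj hi) fun j hj hjm => h.end_le hj hjm
  have h3 : ballCount Y (b i) = lenSum a b (i + 1) :=
    h.ballCount_eq hi (fun j hj => h.end_le (Nat.le_of_lt_succ hj) hi)
      fun j hj hjm => h.le_of_lt hj hjm
  rw [lenSum, Finset.sum_range_succ] at h3
  rw [h2, h3] at h1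
  exact h1

theorem lenSum_bbsStep_le {b' : ℕ → ℕ} (h : IsRunDecomp Y m a b)
    (h' : IsRunDecomp (bbsStep Y) m b b') {i : ℕ} (hi : i < m) :
    lenSum b b' i ≤ lenSum a b i := by
  have h1 := h.card_infCarrier_add_lenSum h' hi
  have h2 := h.len_le_card_infCarrier hi
  omega

theorem lenSum_bbsStep_eq {b' : ℕ → ℕ} (h : IsRunDecomp Y m a b)
    (h' : IsRunDecomp (bbsStep Y) m b b') : lenSum b b' m = lenSum a b m := by
  cases m with
  | zero => rfl
  | succ l =>
    have hY : ∀ s, b l ≤ s → Y s = 0 := fun s hs =>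
      h.eq_zero_of_le fun j hj => (h.end_le (Nat.le_of_lt_succ hj) (by omega)).trans hs
    obtain ⟨T, hT⟩ := infCarrier_eventually_eq_zero hY
    set t := max T (b' l)
    have h1 := card_infCarrier_add_ballCount Y t
    have hbb := h'.lt l (by omega)
    rw [hT t (le_max_left _ _), Multiset.card_zero, zero_add,
      h.ballCount_eq le_rfl (fun j hj => ?_) (fun j _ _ => by omega),
      h'.ballCount_eq le_rfl (fun j hj => ?_) (fun j _ _ => by omega)] at h1
    · exact h1
    · exact (h'.end_le (Nat.le_of_lt_succ hj) (by omega)).trans (le_max_right _ _)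
    · exact ((h.end_le (Nat.le_of_lt_succ hj) (by omega)).trans hbb.le).trans (le_max_right _ _)

end IsRunDecomp

/-! ### Long-time behaviour -/

namespace IsRunDecomp

variable {Y : ℕ → ℕ} {m : ℕ} {a b : ℕ → ℕ}

theorem exists_trajectory (h : IsRunDecomp Y m a b) :
    ∃ p : ℕ → ℕ → ℕ, ∀ t, IsRunDecomp (bbsStep^[t] Y) m (p t) (p (t + 1)) := by
  choose! F hF using fun Z a b => exists_bbsStep (Y := Z) (m := m) (a := a) (b := b)
  let q : ℕ → (ℕ → ℕ) × (ℕ → ℕ) := fun t =>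
    Nat.rec (a, b) (fun t q => (q.2, F (bbsStep^[t] Y) q.1 q.2)) t
  refine ⟨fun t => (q t).1, fun t => ?_⟩
  change IsRunDecomp _ m (q t).1 (q t).2
  induction t with
  | zero => exact h
  | succ t ih =>
    rw [Function.iterate_succ_apply']
    exact hF _ _ _ ih

/-- Eventually the lengths of the runs no longer change. -/
theorem exists_len_eq {p : ℕ → ℕ → ℕ}
    (hp : ∀ t, IsRunDecomp (bbsStep^[t] Y) m (p t) (p (t + 1))) :
    ∃ (T : ℕ) (L : ℕ → ℕ), ∀ t, T ≤ t → ∀ i, i < m →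
      p (t + 1) i = p t i + L i ∧ lenSum (p t) (p (t + 1)) i = lenSum (p T) (p (T + 1)) i := by
  have hstep : ∀ t i, i ≤ m →
      lenSum (p (t + 1)) (p (t + 2)) i ≤ lenSum (p t) (p (t + 1)) i := by
    intro t i hi
    have h1 := hp t
    have h2 := hp (t + 1)
    rw [Function.iterate_succ_apply'] at h2
    rcases hi.lt_or_eq with hi | rfl
    · exact h1.lenSum_bbsStep_le h2 hi
    · exact (h1.lenSum_bbsStep_eq h2).le
  have hanti : ∀ i, i ≤ m → Antitone fun t => lenSum (p t) (p (t + 1)) i := fun i hi =>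
    antitone_nat_of_succ_le fun t => hstep t i hi
  have hsum : Antitone fun t => ∑ i ∈ Finset.range (m + 1), lenSum (p t) (p (t + 1)) i :=
    fun s t hst => Finset.sum_le_sum fun i hi =>
      hanti i (Nat.le_of_lt_succ (Finset.mem_range.1 hi)) hst
  obtain ⟨T, hT⟩ := WellFoundedLT.antitone_chain_condition hsum
  have hconst : ∀ t, T ≤ t → ∀ i, i ≤ m →
      lenSum (p t) (p (t + 1)) i = lenSum (p T) (p (T + 1)) i := by
    intro t ht i hi
    exact (Finset.sum_eq_sum_iff_of_le fun i hi =>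
      hanti i (Nat.le_of_lt_succ (Finset.mem_range.1 hi)) ht).1 (hT t ht).symm i
        (Finset.mem_range.2 (Nat.lt_succ_of_le hi))
  refine ⟨T, fun i => p (T + 1) i - p T i, fun t ht i hi => ⟨?_, hconst t ht i hi.le⟩⟩
  have h1 := hconst t ht i hi.le
  have h2 := hconst t ht (i + 1) hi
  have h3 := (hp t).lt i hi
  have h4 := (hp T).lt i hi
  rw [lenSum, lenSum, Finset.sum_range_succ, Finset.sum_range_succ, ← lenSum, ← lenSum] at h2
  dsimp only
  omega

end IsRunDecomp

/-- A configuration whose runs travel without interaction: their lengths are nondecreasing,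
and every run that is followed by a longer one is separated from it by at least its length. -/
structure IsStable (Y : ℕ → ℕ) (m : ℕ) (a L : ℕ → ℕ) : Prop where
  decomp : IsRunDecomp Y m a fun i => a i + L i
  card_eq : ∀ i, i < m → (infCarrier Y (a i + L i)).card = L i
  sep : ∀ i, i + 1 < m → L i = L (i + 1) ∨ a i + L i + L i ≤ a (i + 1)

theorem IsRunDecomp.congr_end {Y : ℕ → ℕ} {m : ℕ} {a b b' : ℕ → ℕ} (h : IsRunDecomp Y m a b)
    (hb : ∀ i, i < m → b i = b' i) : IsRunDecomp Y m a b' where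
  lt i hi := hb i hi ▸ h.lt i hi
  le i hi := hb i (by omega) ▸ h.le i hi
  pos_iff s := (h.pos_iff s).trans (exists_congr fun i => by
    constructor
    · rintro ⟨h1, h2, h3⟩
      exact ⟨h1, h2, hb i h1 ▸ h3⟩
    · rintro ⟨h1, h2, h3⟩
      exact ⟨h1, h2, (hb i h1).symm ▸ h3⟩)
  anti i hi s h1 h2 := h.anti i hi s h1 ((hb i hi).symm ▸ h2)
  asc i hi h1 := by
    have h2 := hb i (by omega)
    rw [← h2] at h1 ⊢
    exact h.asc i hi h1

theorem exists_isStable {X : ℕ → ℕ} {n : ℕ} (hX : ∀ s, n ≤ s → X s = 0) :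
    ∃ (m T : ℕ) (L : ℕ → ℕ), ∀ t, T ≤ t → ∃ a, IsStable (bbsStep^[t] X) m a L := by
  obtain ⟨m, a, b, h, -⟩ := exists_isRunDecomp n X hX
  obtain ⟨p, hp⟩ := h.exists_trajectory
  obtain ⟨T, L, hT⟩ := IsRunDecomp.exists_len_eq hp
  have hpos : ∀ j i, i < m → p (T + j) i = p T i + j * L i := by
    intro j i hi
    induction j with
    | zero => simp
    | succ j ih =>
      rw [← add_assoc, (hT (T + j) (by omega) i hi).1, ih]
      ring
  have hle : ∀ i, i + 1 < m → ∀ j, p T i + (j + 1) * L i ≤ p T (i + 1) + j * L (i + 1) := by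
    intro i hi j
    rw [← hpos j _ hi, ← hpos (j + 1) i (by omega)]
    exact (hp (T + j)).le i hi
  have hmono : ∀ i, i + 1 < m → L i ≤ L (i + 1) := by
    intro i hi
    by_contra hlt
    have h1 := hle i hi (p T (i + 1) + 1)
    nlinarith
  refine ⟨m, T + ∑ i ∈ Finset.range m, L i, L, fun t ht => ⟨p t, ?_, ?_, ?_⟩⟩
  · exact (hp t).congr_end fun i hi => (hT t (by omega) i hi).1
  · intro i hi
    have h1 := hp t
    have h2 := hp (t + 1)
    rw [Function.iterate_succ_apply'] at h2
    have h3 := h1.card_infCarrier_add_lenSum h2 hi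
    rw [(hT t (by omega) i hi).2, (hT (t + 1) (by omega) i hi).2,
      (hT t (by omega) i hi).1] at h3
    omega
  · intro i hi
    rcases (hmono i hi).eq_or_lt with h1 | h1
    · exact Or.inl h1
    · right
      obtain ⟨j, rfl⟩ := Nat.exists_eq_add_of_le (show T ≤ t by omega)
      have hj : L i ≤ j := by
        have := Finset.single_le_sum (f := L) (fun i _ => Nat.zero_le _)
          (Finset.mem_range.2 (show i < m by omega))
        omega
      rw [hpos j _ hi, hpos j i (by omega)]
      have h2 := hle i hi 0
      nlinarith

theorem IsStable.rowLen_eq {Y : ℕ → ℕ} {m : ℕ} {a L : ℕ → ℕ} (h : IsStable Y m a L) (k : ℕ) :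
    rowLen k Y = ((Finset.range m).filter fun i => k ≤ L i).card := by
  simp [h.decomp.rowLen_eq k]

/-! ### Energy of a stable configuration -/

theorem energy_eq_of_forall_eq_zero {k : ℕ} {Y : ℕ → ℕ} {s t : ℕ} (hst : s ≤ t)
    (h : ∀ u, s ≤ u → u < t → Y u = 0) : energy k Y t = energy k Y s := by
  induction t, hst using Nat.le_induction with
  | base => rfl
  | succ t hst ih =>
    rw [energy_succ_of_eq_zero (h t hst (by omega)), ih fun u h1 h2 => h u h1 (by omega)]

theorem energy_add_le_len (k : ℕ) (Y : ℕ → ℕ) (t l : ℕ) :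
    energy k Y (t + l) ≤ energy k Y t + l := by
  induction l with
  | zero => exact le_rfl
  | succ l ih => exact (profStep_le _ _ _ _).trans (Nat.succ_le_succ ih)

theorem energy_add_le_of_anti {k : ℕ} {Y : ℕ → ℕ} {t l : ℕ}
    (h : ∀ s, t ≤ s → s + 1 < t + l → Y (s + 1) ≤ Y s) :
    energy k Y (t + l) ≤ energy k Y t + k := by
  have hprof := fun s => (isProfile_vacuum k).profile Y s
  cases l with
  | zero => exact Nat.le_add_right _ _
  | succ l =>
    have key : ∀ j, j ≤ l →
        profile k (vacuum k) Y (t + j + 1) (Y (t + j)) ≤ energy k Y t + k := by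
      intro j hj
      have h1 : profile k (vacuum k) Y (t + j + 1) (Y (t + j)) ≤
          profile k (vacuum k) Y (t + j) (Y (t + j)) := by
        simp [profile, profStep]
      refine h1.trans ?_
      induction j with
      | zero => exact (hprof t).le_add _
      | succ j ih =>
        refine ((hprof _).mono (h (t + j) (by omega) (by omega))).trans ?_
        have h2 : profile k (vacuum k) Y (t + j + 1) (Y (t + j)) ≤
            profile k (vacuum k) Y (t + j) (Y (t + j)) := by
          simp [profile, profStep]
        exact h2.trans (ih (by omega) h2)
    exact ((hprof _).mono (Nat.zero_le _)).trans (key l le_rfl)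

theorem IsRunDecomp.eq_zero_of_gap {Y : ℕ → ℕ} {m : ℕ} {a b : ℕ → ℕ} (h : IsRunDecomp Y m a b)
    {i s : ℕ} (hi : i < m) (h1 : ∀ j, j + 1 = i → b j ≤ s) (h2 : s < a i) : Y s = 0 := by
  by_contra h0
  obtain ⟨j, hj, h3, h4⟩ := (h.pos_iff s).1 (Nat.pos_of_ne_zero h0)
  rcases lt_trichotomy j i with hji | rfl | hji
  · cases i with
    | zero => omega
    | succ i =>
      have h5 := h1 i rfl
      have h6 := h.end_le (show j ≤ i by omega) (by omega)
      omega
  · omega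
  · have h5 := h.start_lt hji hj
    omega

theorem IsRunDecomp.energy_run_le {Y : ℕ → ℕ} {m : ℕ} {a L : ℕ → ℕ}
    (h : IsRunDecomp Y m a fun i => a i + L i) (k : ℕ) {i : ℕ} (hi : i < m) :
    energy k Y (a i + L i) ≤ energy k Y (a i) + min (L i) k := by
  rw [← min_add_add_left]
  exact le_min (energy_add_le_len _ _ _ _) (energy_add_le_of_anti (h.anti i hi))

theorem IsRunDecomp.energy_le {Y : ℕ → ℕ} {m : ℕ} {a L : ℕ → ℕ}
    (h : IsRunDecomp Y m a fun i => a i + L i) (k : ℕ) {i : ℕ} (hi : i < m) :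
    energy k Y (a i + L i) ≤ ∑ j ∈ Finset.range (i + 1), min (L j) k := by
  rw [Finset.sum_range_succ]
  refine (h.energy_run_le k hi).trans (Nat.add_le_add_right ?_ _)
  induction i with
  | zero =>
    rw [energy_eq_of_forall_eq_zero (Nat.zero_le (a 0)) fun u _ hu =>
      h.eq_zero_of_gap hi (by simp) hu]
    simp [energy, profile, vacuum]
  | succ i ih =>
    rw [energy_eq_of_forall_eq_zero (h.le i hi) fun u h1 hu =>
      h.eq_zero_of_gap hi (fun j hj => by rwa [show j = i by omega]) hu, Finset.sum_range_succ]
    exact (h.energy_run_le k (by omega)).trans (Nat.add_le_add_right (ih (by omega)) _)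

/-- A lower bound for a cost profile in terms of the infinite-capacity carrier `x`, in which
every ball in the carrier is worth `r`. -/
structure CarrierBound (k : ℕ) (r W : ℚ) (V : ℕ → ℕ) (x : Multiset ℕ) : Prop where
  zero : W ≤ V 0
  pos : ∀ c, 1 ≤ c → W + k ≤ V c + r * x.countP (c ≤ ·)

namespace CarrierBound

variable {k : ℕ} {r W : ℚ} {V : ℕ → ℕ} {x : Multiset ℕ}

theorem of_empty (h : CarrierBound k r W V 0) (r' : ℚ) : CarrierBound k r' W V 0 :=
  ⟨h.zero, by simpa using h.pos⟩

theorem countP_erase_infOut (x : Multiset ℕ) (y : ℕ) {c : ℕ} (hc : 1 ≤ c) :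
    (x.erase (infOut x y)).countP (c ≤ ·) + (if c ≤ infOut x y then 1 else 0) =
      x.countP (c ≤ ·) := by
  rcases infOut_eq_zero_or_mem x y with h | h
  · rw [h, if_neg (by omega), add_zero]
    by_cases h0 : 0 ∈ x
    · conv_rhs => rw [← Multiset.cons_erase h0, Multiset.countP_cons_of_neg _ (by omega)]
    · rw [Multiset.erase_of_notMem h0]
  · conv_rhs => rw [← Multiset.cons_erase h, Multiset.countP_cons]

theorem infStep_zero (h : CarrierBound k r W V x) (hr0 : 0 ≤ r) (hr1 : r ≤ 1) :
    CarrierBound k r W (profStep k V 0) (infStep x 0) := by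
  have h0 := h.zero
  constructor
  · simpa [profStep] using h0
  · intro c hc
    have h1 := h.pos c hc
    rw [_root_.infStep_zero, profStep, if_pos (by omega), Nat.cast_min, ← min_add_add_right]
    have h2 := countP_erase_infOut x 0 hc
    generalize (x.erase (infOut x 0)).countP (c ≤ ·) = u at *
    generalize x.countP (c ≤ ·) = v at *
    have h3 : (v : ℚ) ≤ u + 1 := by
      have : v ≤ u + 1 := by split_ifs at h2 <;> omega
      exact_mod_cast this
    have h4 : (0 : ℚ) ≤ u := Nat.cast_nonneg _
    push_cast
    refine le_min ?_ ?_
    · nlinarith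
    · nlinarith

theorem infStep_pos (h : CarrierBound k r W V x) (hr0 : 0 ≤ r) (hr1 : r ≤ 1) {y : ℕ}
    (hy : y ≠ 0) (hcard : r * (infStep x y).card ≤ k) :
    CarrierBound k r (W + r) (profStep k V y) (infStep x y) := by
  have h0 := h.zero
  have hyy := h.pos y (by omega)
  have hw := infOut_lt x hy
  have hcount : ∀ c, 1 ≤ c → (infStep x y).countP (c ≤ ·) + (if c ≤ infOut x y then 1 else 0) =
      x.countP (c ≤ ·) + if c ≤ y then 1 else 0 := by
    intro c hc
    rw [infStep_of_ne_zero _ hy, Multiset.countP_cons, ← countP_erase_infOut x y hc]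
    omega
  have hle : ∀ c, r * (infStep x y).countP (c ≤ ·) ≤ k := fun c =>
    (mul_le_mul_of_nonneg_left (Nat.cast_le.2 (Multiset.countP_le_card _ _)) hr0).trans hcard
  have hcy := hcount y (by omega)
  rw [if_neg (by omega), if_pos le_rfl, add_zero] at hcy
  have hly := hle y
  rw [hcy] at hly
  push_cast at hly
  constructor
  · simp only [profStep, Nat.not_lt_zero, if_false, add_zero, Nat.cast_min]
    refine le_min ?_ ?_
    · push_cast
      linarith
    · linarith
  · intro c hc
    have h1 := h.pos c hc
    have h2 := hcount c hc
    have h4 : 0 ≤ r * (infStep x y).countP (c ≤ ·) := by positivity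
    rw [profStep, Nat.cast_min, ← min_add_add_right]
    refine le_min ?_ ?_
    · have h3 : x.countP (c ≤ ·) ≤ (infStep x y).countP (c ≤ ·) := by split_ifs at h2 <;> omega
      have h5 := mul_le_mul_of_nonneg_left (Nat.cast_le (α := ℚ).2 h3) hr0
      push_cast
      linarith
    · by_cases hyc : y < c
      · rw [if_pos hyc]
        push_cast
        linarith
      · have h3 : (infStep x y).countP (y ≤ ·) ≤ (infStep x y).countP (c ≤ ·) := by
          rw [Multiset.countP_eq_card_filter, Multiset.countP_eq_card_filter]
          exact Multiset.card_le_card (Multiset.monotone_filter_right _ fun z hz =>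
            (not_lt.1 hyc).trans hz)
        have h5 := mul_le_mul_of_nonneg_left (Nat.cast_le (α := ℚ).2 h3) hr0
        rw [hcy] at h5
        rw [if_neg hyc]
        push_cast at h5 ⊢
        linarith

theorem of_forall_eq_zero {Y : ℕ → ℕ} {s t : ℕ} (hr0 : 0 ≤ r) (hr1 : r ≤ 1) (hst : s ≤ t)
    (hY : ∀ u, s ≤ u → u < t → Y u = 0)
    (h : CarrierBound k r W (profile k (vacuum k) Y s) (infCarrier Y s)) :
    CarrierBound k r W (profile k (vacuum k) Y t) (infCarrier Y t) := by
  induction t, hst using Nat.le_induction with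
  | base => exact h
  | succ t hst ih =>
    have h1 := (ih fun u h1 h2 => hY u h1 (by omega)).infStep_zero hr0 hr1
    rwa [← hY t hst (by omega)] at h1

theorem of_forall_pos {Y : ℕ → ℕ} {s l : ℕ} (hr0 : 0 ≤ r) (hr1 : r ≤ 1)
    (hY : ∀ u, s ≤ u → u < s + l → 0 < Y u) (hcard : r * (infCarrier Y (s + l)).card ≤ k)
    (h : CarrierBound k r W (profile k (vacuum k) Y s) (infCarrier Y s)) :
    CarrierBound k r (W + l * r) (profile k (vacuum k) Y (s + l)) (infCarrier Y (s + l)) := by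
  induction l with
  | zero => simpa using h
  | succ l ih =>
    have hpos := hY (s + l) (by omega) (by omega)
    have h1 : (infCarrier Y (s + l)).card ≤ (infCarrier Y (s + (l + 1))).card := by
      have h2 := card_infStep (zero_notMem_infCarrier Y (s + l)) (Y (s + l))
      rw [if_pos hpos] at h2
      rw [← add_assoc, infCarrier]
      split_ifs at h2 <;> omega
    have h3 := ih (fun u h1 h2 => hY u h1 (by omega))
      ((mul_le_mul_of_nonneg_left (Nat.cast_le.2 h1) hr0).trans hcard)
    have h4 := h3.infStep_pos hr0 hr1 hpos.ne' hcard
    push_cast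
    rw [show W + (l + 1) * r = W + l * r + r by ring]
    exact h4

end CarrierBound

theorem IsStable.carrierBound {Y : ℕ → ℕ} {m : ℕ} {a L : ℕ → ℕ} (h : IsStable Y m a L)
    (k : ℕ) {i : ℕ} (hi : i < m) :
    CarrierBound k (min 1 (k / L i)) (∑ j ∈ Finset.range (i + 1), min (L j) k : ℕ)
      (profile k (vacuum k) Y (a i + L i)) (infCarrier Y (a i + L i)) := by
  have hr0 : ∀ j, 0 ≤ min (1 : ℚ) (k / L j) := fun j =>
    le_min zero_le_one (div_nonneg (Nat.cast_nonneg _) (Nat.cast_nonneg _))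
  have hr1 : ∀ j, min (1 : ℚ) (k / L j) ≤ 1 := fun j => min_le_left _ _
  have hmul : ∀ j, j < m → (L j : ℚ) * min (1 : ℚ) (k / L j) = (min (L j) k : ℕ) := by
    intro j hj
    have h1 : (0 : ℚ) < L j := by
      have := h.decomp.lt j hj
      exact_mod_cast (by omega : 0 < L j)
    rw [mul_min_of_nonneg _ _ h1.le, mul_one, mul_div_cancel₀ _ h1.ne', Nat.cast_min]
  suffices hs : CarrierBound k (min 1 (k / L i)) (∑ j ∈ Finset.range i, min (L j) k : ℕ)
      (profile k (vacuum k) Y (a i)) (infCarrier Y (a i)) by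
    rw [Finset.sum_range_succ, Nat.cast_add, ← hmul i hi]
    refine hs.of_forall_pos (hr0 i) (hr1 i)
      (fun u h1 h2 => (h.decomp.pos_iff u).2 ⟨i, hi, h1, h2⟩) ?_
    rw [h.card_eq i hi, mul_comm, hmul i hi]
    exact Nat.cast_le.2 (min_le_right _ _)
  induction i with
  | zero =>
    refine CarrierBound.of_forall_eq_zero (hr0 0) (hr1 0) (Nat.zero_le _)
      (fun u _ hu => h.decomp.eq_zero_of_gap hi (by simp) hu) ⟨by simp, fun c hc => ?_⟩
    simp [profile, vacuum, infCarrier, show c ≠ 0 by omega]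
  | succ i ih =>
    have hi' : i < m := by omega
    have hgap : ∀ u, a i + L i ≤ u → u < a (i + 1) → Y u = 0 := fun u h1 hu =>
      h.decomp.eq_zero_of_gap hi (fun j hj => by rwa [show j = i by omega]) hu
    have hs := ih hi'
    have h1 := hs.of_forall_pos (hr0 i) (hr1 i)
      (fun u h1 h2 => (h.decomp.pos_iff u).2 ⟨i, hi', h1, h2⟩) (by
        rw [h.card_eq i hi', mul_comm, hmul i hi']
        exact Nat.cast_le.2 (min_le_right _ _))
    rw [hmul i hi', ← Nat.cast_add, ← Finset.sum_range_succ] at h1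
    have h2 := h1.of_forall_eq_zero (hr0 i) (hr1 i) (h.decomp.le i hi) hgap
    rcases h.sep i hi with h3 | h3
    · rwa [← h3]
    · rw [infCarrier_eq_zero hgap (by rwa [h.card_eq i hi'])] at h2 ⊢
      exact h2.of_empty _

theorem IsStable.energy_eq {Y : ℕ → ℕ} {m : ℕ} {a L : ℕ → ℕ} (h : IsStable Y m a L) (k : ℕ) :
    ∃ T, ∀ t, T ≤ t → energy k Y t = ∑ i ∈ Finset.range m, min (L i) k := by
  cases m with
  | zero =>
    refine ⟨0, fun t _ => ?_⟩
    rw [energy_eq_of_le (n := 0) (fun s _ => h.decomp.eq_zero_of_le (by simp)) (Nat.zero_le t)]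
    simp [energy, profile, vacuum]
  | succ l =>
    refine ⟨a l + L l, fun t ht => ?_⟩
    rw [energy_eq_of_le (n := a l + L l) (fun s hs => h.decomp.eq_zero_of_le fun j hj =>
      (h.decomp.end_le (Nat.le_of_lt_succ hj) (by omega)).trans hs) ht]
    exact (h.decomp.energy_le k (Nat.lt_succ_self l)).antisymm
      (Nat.cast_le.1 (h.carrierBound k (Nat.lt_succ_self l)).zero)

/-- The row lengths of the invariant Young diagram are the increments of the energies. -/
theorem solRow_add_energy {X : ℕ → ℕ} {N n : ℕ} (hN : ∀ s, X s < N) (hn : ∀ s, n ≤ s → X s = 0)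
    (k : ℕ) : solRow (k + 1) X + energy k X n = energy (k + 1) X n := by
  obtain ⟨m, T, L, hT⟩ := exists_isStable hn
  have hE : ∀ k, energy k X n = ∑ i ∈ Finset.range m, min (L i) k := by
    intro k
    obtain ⟨a, ha⟩ := hT T le_rfl
    obtain ⟨T1, h1⟩ := ha.energy_eq k
    obtain ⟨T2, h2⟩ := energy_iterate_bbsStep k hN hn T
    rw [← h2 _ (le_max_right T1 T2), h1 _ (le_max_left T1 T2)]
  have hrow : ∀ t, T ≤ t → rowLen (k + 1) (bbsStep^[t] X) =
      ((Finset.range m).filter fun i => k + 1 ≤ L i).card := by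
    intro t ht
    obtain ⟨a, ha⟩ := hT t ht
    exact ha.rowLen_eq _
  have hset : {v | ∀ᶠ t in Filter.atTop, rowLen (k + 1) (bbsStep^[t] X) = v} =
      {((Finset.range m).filter fun i => k + 1 ≤ L i).card} := by
    ext v
    rw [Set.mem_singleton_iff]
    constructor
    · intro hv
      obtain ⟨t, h1, h2⟩ := (hv.and (Filter.eventually_ge_atTop T)).exists
      rw [← h1, hrow t h2]
    · rintro rfl
      filter_upwards [Filter.eventually_ge_atTop T] with t ht using hrow t ht
  rw [solRow, hset, csSup_singleton, hE, hE, Finset.card_filter, ← Finset.sum_add_distrib]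
  refine Finset.sum_congr rfl fun i _ => ?_
  split_ifs <;> omega

/-! ### The circular exclusion carrier -/

theorem profile_add (k : ℕ) (V X : ℕ → ℕ) (s t : ℕ) :
    profile k V X (s + t) = profile k (profile k V X s) (fun u => X (s + u)) t := by
  induction t with
  | zero => rfl
  | succ t ih => rw [← add_assoc, profile, profile, ih]

theorem profile_le_add (k : ℕ) (V X : ℕ → ℕ) (t c : ℕ) : profile k V X t c ≤ V c + t := by
  induction t with
  | zero => exact le_rfl
  | succ t ih => exact (profStep_le _ _ _ _).trans (Nat.succ_le_succ ih)

section CircularExclusion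

variable {n : ℕ}

/-- In the circular exclusion carrier `Γ`, the incoming letter `y` replaces `w`: the largest
letter below `y` or, if there is none, the largest letter. -/
def IsEjected (Γ : Finset (Fin n)) (y w : Fin n) : Prop :=
  w ∈ Γ ∧ ((w < y ∧ ∀ x ∈ Γ, x < y → x ≤ w) ∨ ∀ x ∈ Γ, y < x ∧ x ≤ w)

theorem exists_isEjected {Γ : Finset (Fin n)} (hΓ : Γ.Nonempty) {y : Fin n} (hy : y ∉ Γ) :
    ∃ w, IsEjected Γ y w := by
  by_cases h : (Γ.filter (· < y)).Nonempty
  · obtain ⟨h1, h2⟩ := Finset.mem_filter.1 (Finset.max'_mem _ h)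
    exact ⟨_, h1, Or.inl ⟨h2, fun x hx hxy =>
      Finset.le_max' _ _ (Finset.mem_filter.2 ⟨hx, hxy⟩)⟩⟩
  · refine ⟨_, Finset.max'_mem _ hΓ, Or.inr fun x hx => ⟨?_, Finset.le_max' _ _ hx⟩⟩
    rw [Finset.not_nonempty_iff_eq_empty, Finset.filter_eq_empty_iff] at h
    exact lt_of_le_of_ne (not_lt.1 (h hx)) fun h' => hy (h' ▸ hx)

theorem IsEjected.unique {Γ Γ' : Finset (Fin n)} {y y' w : Fin n} (h : IsEjected Γ y w)
    (h' : IsEjected Γ' y' w) (hΓ : insert y (Γ.erase w) = insert y' (Γ'.erase w)) : y = y' := by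
  have key : ∀ {Γ : Finset (Fin n)} {y : Fin n}, IsEjected Γ y w →
      (w < y ∧ ∀ x ∈ insert y (Γ.erase w), w < x → y ≤ x) ∨
        ∀ x ∈ insert y (Γ.erase w), y ≤ x ∧ x ≤ w := by
    rintro Γ y ⟨hw, ⟨h1, h2⟩ | h1⟩
    · refine Or.inl ⟨h1, fun x hx hwx => ?_⟩
      rcases Finset.mem_insert.1 hx with rfl | hx
      · exact le_rfl
      · by_contra hxy
        exact (h2 x (Finset.mem_of_mem_erase hx) (not_le.1 hxy)).not_gt hwx
    · refine Or.inr fun x hx => ?_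
      rcases Finset.mem_insert.1 hx with rfl | hx
      · exact ⟨le_rfl, (h1 w hw).1.le⟩
      · exact ⟨(h1 x (Finset.mem_of_mem_erase hx)).1.le, (h1 x (Finset.mem_of_mem_erase hx)).2⟩
  have hy := Finset.mem_insert_self y (Γ.erase w)
  have hy' := Finset.mem_insert_self y' (Γ'.erase w)
  have k1 := key h
  have k2 := key h'
  rw [hΓ] at k1 hy
  rcases k1 with ⟨h1, h2⟩ | h1 <;> rcases k2 with ⟨h3, h4⟩ | h3
  · exact le_antisymm (h2 _ hy' h3) (h4 _ hy h1)
  · exact absurd h1 (h3 _ hy).2.not_gt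
  · exact absurd h3 (h1 _ hy').2.not_gt
  · exact le_antisymm (h1 _ hy').1 (h3 _ hy).1

/-- The cost profile determined by the circular exclusion carrier `Γ`. -/
def ringProfile (Γ : Finset (Fin n)) (c : ℕ) : ℕ := (Γ.filter fun x : Fin n => (x : ℕ) + 1 < c).card

theorem ringProfile_le_card (Γ : Finset (Fin n)) (c : ℕ) : ringProfile Γ c ≤ Γ.card :=
  Finset.card_filter_le _ _

theorem isProfile_ringProfile (Γ : Finset (Fin n)) : IsProfile Γ.card (ringProfile Γ) where
  mono _ _ h := Finset.card_le_card (Finset.monotone_filter_right _ fun _ _ hx => hx.trans_le h)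
  le_add c := (ringProfile_le_card Γ c).trans (Nat.le_add_left _ _)

open Classical in
theorem profStep_ringProfile {Γ : Finset (Fin n)} {y w : Fin n} (hy : y ∉ Γ)
    (hw : IsEjected Γ y w) (e c : ℕ) :
    profStep Γ.card (fun c => e + ringProfile Γ c) (y + 1) c =
      e + (if ∃ x ∈ Γ, x < y then 1 else 0) + ringProfile (insert y (Γ.erase w)) c := by
  have h1 : ringProfile (insert y (Γ.erase w)) c + (if (w : ℕ) + 1 < c then 1 else 0) =
      ringProfile Γ c + if (y : ℕ) + 1 < c then 1 else 0 := by
    conv_rhs => rw [ringProfile, ← Finset.insert_erase hw.1]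
    have hy' : y ∉ Γ.erase w := fun h => hy (Finset.mem_of_mem_erase h)
    rw [ringProfile, Finset.filter_insert, Finset.filter_insert]
    split_ifs <;> simp [Finset.card_insert_of_notMem, hy']
  have hcard := ringProfile_le_card Γ c
  have hcard1 : 1 ≤ Γ.card := Finset.card_pos.2 ⟨w, hw.1⟩
  have hmem : w ∈ Γ := hw.1
  simp only [profStep]
  rcases hw.2 with ⟨hwy, hmax⟩ | hmin
  · have hex : (if ∃ x ∈ Γ, x < y then 1 else 0) = 1 := if_pos ⟨w, hmem, hwy⟩
    rw [hex]
    have hwy' : (w : ℕ) < y := hwy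
    have hpos : 1 ≤ ringProfile Γ (y + 1) :=
      Finset.card_pos.2 ⟨w, Finset.mem_filter.2 ⟨hmem, by omega⟩⟩
    by_cases hc1 : (w : ℕ) + 1 < c
    · by_cases hc2 : (y : ℕ) + 1 < c
      · rw [if_pos hc1, if_pos hc2] at h1
        rw [if_pos hc2]
        omega
      · rw [if_pos hc1, if_neg hc2] at h1
        rw [if_neg hc2]
        have h2 : ringProfile Γ (y + 1) = ringProfile Γ c := by
          unfold ringProfile
          congr 1
          refine Finset.filter_congr fun x hx => ⟨fun h => ?_, fun h => by omega⟩
          have h3 : (x : ℕ) ≤ w := hmax x hx (Fin.lt_def.2 (by omega))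
          omega
        omega
    · rw [if_neg hc1, if_neg (by omega)] at h1
      rw [if_neg (by omega)]
      have h2 : ringProfile Γ c < ringProfile Γ (y + 1) := by
        refine Finset.card_lt_card (Finset.ssubset_iff_of_subset
          (Finset.monotone_filter_right _ fun x _ hx => by omega) |>.2 ⟨w, ?_, ?_⟩)
        · exact Finset.mem_filter.2 ⟨hmem, by omega⟩
        · simp [hc1]
      omega
  · have hex : (if ∃ x ∈ Γ, x < y then 1 else 0) = 0 :=
      if_neg fun ⟨x, hx, hxy⟩ => (hmin x hx).1.not_gt hxy
    rw [hex]
    have hyw : (y : ℕ) < w := (hmin w hmem).1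
    have h0 : ∀ d, d ≤ (y : ℕ) + 1 → ringProfile Γ d = 0 := by
      intro d hd
      refine Finset.card_eq_zero.2 (Finset.filter_eq_empty_iff.2 fun x hx => ?_)
      have h2 : (y : ℕ) < x := (hmin x hx).1
      omega
    rw [h0 _ le_rfl]
    by_cases hc2 : (y : ℕ) + 1 < c
    · rw [if_pos hc2] at h1 ⊢
      by_cases hc1 : (w : ℕ) + 1 < c
      · rw [if_pos hc1] at h1
        have h2 : ringProfile Γ c = Γ.card := by
          unfold ringProfile
          rw [Finset.filter_true_of_mem fun x hx => ?_]
          have h3 : (x : ℕ) ≤ w := (hmin x hx).2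
          omega
        omega
      · rw [if_neg hc1] at h1
        have h2 : ringProfile Γ c < Γ.card :=
          Finset.card_lt_card (Finset.filter_ssubset.2 ⟨w, hmem, hc1⟩)
        omega
    · rw [if_neg hc2, if_neg (by omega), h0 c (by omega)] at h1
      rw [if_neg hc2]
      omega

/-- The set of the first `k` letters of a permutation. -/
def firstLetters (k : ℕ) (σ : Equiv.Perm (Fin n)) : Finset (Fin n) :=
  Finset.univ.filter fun x => (σ.symm x : ℕ) < k

theorem mem_firstLetters {k : ℕ} {σ : Equiv.Perm (Fin n)} {x : Fin n} :
    x ∈ firstLetters k σ ↔ (σ.symm x : ℕ) < k := by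
  simp [firstLetters]

theorem apply_mem_firstLetters {k : ℕ} {σ : Equiv.Perm (Fin n)} {p : Fin n} :
    σ p ∈ firstLetters k σ ↔ (p : ℕ) < k := by
  simp [firstLetters]

theorem card_firstLetters {k : ℕ} (hk : k ≤ n) (σ : Equiv.Perm (Fin n)) :
    (firstLetters k σ).card = k := by
  have h : firstLetters k σ = (Finset.univ.filter fun x : Fin n => (x : ℕ) < k).map
      σ.toEmbedding := by
    ext x
    simp [firstLetters]
  rw [h, Finset.card_map]
  simpa [Fin.card_filter_val_lt] using hk

theorem firstLetters_swap_mul {k : ℕ} {σ : Equiv.Perm (Fin n)} {p w : Fin n}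
    (hp : k ≤ p) (hw : w ∈ firstLetters k σ) :
    firstLetters k (Equiv.swap (σ p) w * σ) = insert (σ p) ((firstLetters k σ).erase w) := by
  ext x
  rw [mem_firstLetters, Finset.mem_insert, Finset.mem_erase, mem_firstLetters]
  rw [mem_firstLetters] at hw
  have hx : (Equiv.swap (σ p) w * σ).symm x = σ.symm (Equiv.swap (σ p) w x) := by
    rw [Equiv.symm_apply_eq]
    simp
  rw [hx]
  by_cases h1 : x = σ p
  · subst h1
    simpa using hw
  · by_cases h2 : x = w
    · subst h2
      simp [h1, hp]
    · rw [Equiv.swap_apply_of_ne_of_ne h1 h2]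
      simp [h1, h2]

/-- Updating the carrier is a bijection of permutations. -/
theorem exists_carrierEquiv {k : ℕ} (hk : 1 ≤ k) (hkn : k ≤ n) {p : Fin n} (hp : k ≤ p) :
    ∃ Ψ : Equiv.Perm (Fin n) ≃ Equiv.Perm (Fin n), ∀ σ, ∃ w,
      IsEjected (firstLetters k σ) (σ p) w ∧ Ψ σ = Equiv.swap (σ p) w * σ := by
  have hex : ∀ σ : Equiv.Perm (Fin n), ∃ w, IsEjected (firstLetters k σ) (σ p) w := fun σ =>
    exists_isEjected (Finset.card_pos.1 (by rw [card_firstLetters hkn]; exact hk))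
      fun h => absurd (apply_mem_firstLetters.1 h) (not_lt.2 hp)
  choose w hw using hex
  have hinj : Function.Injective fun σ => Equiv.swap (σ p) (w σ) * σ := by
    intro σ τ h
    dsimp only at h
    have h1 : w σ = w τ := by simpa using congrArg (fun ρ => ρ p) h
    have h2 := congrArg (firstLetters k) h
    rw [firstLetters_swap_mul hp (hw σ).1, firstLetters_swap_mul hp (hw τ).1, h1] at h2
    have h3 := (h1 ▸ hw σ).unique (hw τ) h2
    rw [h1, h3] at h
    exact mul_left_cancel h
  exact ⟨Equiv.ofBijective _ (Finite.injective_iff_bijective.1 hinj), fun σ => ⟨w σ, hw σ, rfl⟩⟩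

open Classical in
/-- A letter `p ≥ k` exceeds some of the first `k` letters with probability `k / (k + 1)`. -/
theorem sum_exists_lt {k : ℕ} (hkn : k ≤ n) {p : Fin n} (hp : k ≤ p) :
    (k + 1) * ∑ σ : Equiv.Perm (Fin n), (if ∃ x ∈ firstLetters k σ, x < σ p then 1 else 0) =
      k * n.factorial := by
  let S : Finset (Fin n) := insert p (Finset.univ.filter fun i => (i : ℕ) < k)
  have hpS : p ∉ Finset.univ.filter fun i : Fin n => (i : ℕ) < k := by simp [hp]
  have hS : S.card = k + 1 := by
    rw [Finset.card_insert_of_notMem hpS]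
    simpa [Fin.card_filter_val_lt] using hkn
  let N : Fin n → ℕ := fun j =>
    ∑ σ : Equiv.Perm (Fin n), if ∀ i ∈ S, σ j ≤ σ i then 1 else 0
  have hsum : ∑ j ∈ S, N j = n.factorial := by
    rw [Finset.sum_comm]
    have h1 : ∀ σ : Equiv.Perm (Fin n), ∑ j ∈ S, (if ∀ i ∈ S, σ j ≤ σ i then 1 else 0) = 1 := by
      intro σ
      obtain ⟨j, hj, hmin⟩ := S.exists_min_image σ ⟨p, Finset.mem_insert_self _ _⟩
      rw [Finset.sum_eq_single_of_mem j hj, if_pos hmin]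
      intro i hi hij
      rw [if_neg]
      intro h
      exact hij (σ.injective (le_antisymm (h j hj) (hmin i hi)))
    simp [h1, Fintype.card_perm]
  have hN : ∀ j ∈ S, N j = N p := by
    intro j hj
    have hswap : ∀ i ∈ S, Equiv.swap j p i ∈ S := by
      intro i hi
      by_cases h1 : i = j
      · rw [h1, Equiv.swap_apply_left]
        exact Finset.mem_insert_self _ _
      · by_cases h2 : i = p
        · rw [h2, Equiv.swap_apply_right]
          exact hj
        · rwa [Equiv.swap_apply_of_ne_of_ne h1 h2]
    refine Fintype.sum_equiv (Equiv.mulRight (Equiv.swap j p)) _ _ fun σ => ?_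
    refine if_congr ⟨fun h i hi => ?_, fun h i hi => ?_⟩ rfl rfl
    · simpa using h _ (hswap i hi)
    · simpa using h _ (hswap i hi)
  rw [Finset.sum_congr rfl hN, Finset.sum_const, hS, smul_eq_mul] at hsum
  have hcompl : N p + ∑ σ : Equiv.Perm (Fin n),
      (if ∃ x ∈ firstLetters k σ, x < σ p then 1 else 0) = n.factorial := by
    rw [← Finset.sum_add_distrib]
    have h1 : ∀ σ : Equiv.Perm (Fin n), ((if ∀ i ∈ S, σ p ≤ σ i then 1 else 0) +
        if ∃ x ∈ firstLetters k σ, x < σ p then 1 else 0) = 1 := by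
      intro σ
      have h2 : (∃ x ∈ firstLetters k σ, x < σ p) ↔ ¬ ∀ i ∈ S, σ p ≤ σ i := by
        push Not
        constructor
        · rintro ⟨x, hx, hlt⟩
          refine ⟨σ.symm x, Finset.mem_insert_of_mem ?_, by simpa using hlt⟩
          simpa using mem_firstLetters.1 hx
        · rintro ⟨i, hi, hlt⟩
          rcases Finset.mem_insert.1 hi with rfl | hi
          · exact absurd hlt (lt_irrefl _)
          · exact ⟨σ i, apply_mem_firstLetters.2 (by simpa using hi), hlt⟩
      by_cases h : ∀ i ∈ S, σ p ≤ σ i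
      · rw [if_pos h, if_neg fun h' => h2.1 h' h]
      · rw [if_neg h, if_pos (h2.2 h)]
    simp [h1, Fintype.card_perm]
  nlinarith

theorem permCfg_of_lt {σ : Equiv.Perm (Fin n)} (p : Fin n) : permCfg n σ p = σ p + 1 := by
  simp [permCfg]

/-- Running the circular exclusion carrier over a uniformly random permutation. -/
theorem exists_carrier_trajectory {k : ℕ} (hk : 1 ≤ k) (t : ℕ) (hkt : k + t ≤ n) :
    ∃ (Φ : Equiv.Perm (Fin n) ≃ Equiv.Perm (Fin n)) (e : Equiv.Perm (Fin n) → ℕ),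
      (∀ σ c, profile k (ringProfile (firstLetters k σ)) (fun s => permCfg n σ (k + s)) t c =
        e σ + ringProfile (firstLetters k (Φ σ)) c) ∧
      (∀ σ, ∀ p : Fin n, k + t ≤ p → Φ σ p = σ p) ∧
      (k + 1) * ∑ σ, e σ = t * (k * n.factorial) := by
  classical
  induction t with
  | zero => exact ⟨Equiv.refl _, 0, by simp [profile]⟩
  | succ t ih =>
    obtain ⟨Φ, e, h1, h2, h3⟩ := ih (by omega)
    let p : Fin n := ⟨k + t, by omega⟩
    have hp : k ≤ p := Nat.le_add_right _ _
    obtain ⟨Ψ, hΨ⟩ := exists_carrierEquiv hk (by omega) hp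
    refine ⟨Φ.trans Ψ, fun σ => e σ + if ∃ x ∈ firstLetters k (Φ σ), x < Φ σ p then 1 else 0,
      fun σ c => ?_, fun σ q hq => ?_, ?_⟩
    · obtain ⟨w, hw, hΨw⟩ := hΨ (Φ σ)
      have hy : Φ σ p ∉ firstLetters k (Φ σ) := fun h =>
        absurd (apply_mem_firstLetters.1 h) (not_lt.2 hp)
      have h4 := profStep_ringProfile hy hw (e σ) c
      rw [card_firstLetters (by omega), ← firstLetters_swap_mul hp hw.1, ← hΨw] at h4
      rw [Equiv.trans_apply, ← h4, profile, funext (h1 σ)]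
      congr 1
      rw [h2 σ p le_rfl]
      exact permCfg_of_lt p
    · obtain ⟨w, hw, hΨw⟩ := hΨ (Φ σ)
      have hq' : k + t < q := by omega
      rw [Equiv.trans_apply, hΨw, Equiv.Perm.mul_apply, Equiv.swap_apply_of_ne_of_ne,
        h2 σ q hq'.le]
      · intro h
        have h4 := congrArg Fin.val ((Φ σ).injective h)
        exact hq'.ne' h4
      · rintro rfl
        have h4 := apply_mem_firstLetters.1 hw.1
        omega
    · rw [Finset.sum_add_distrib, mul_add, h3,
        Equiv.sum_comp Φ fun τ => if ∃ x ∈ firstLetters k τ, x < τ p then 1 else 0,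
        sum_exists_lt (by omega) hp]
      ring

/-- The mean of the energy of a uniformly random permutation. -/
theorem abs_sum_energy_sub_le {k : ℕ} (hk : 1 ≤ k) (hkn : k ≤ n) :
    |∑ σ : Equiv.Perm (Fin n), (energy k (permCfg n σ) n : ℝ) -
      n.factorial * (n * (k / (k + 1)))| ≤ n.factorial * (3 * k) := by
  obtain ⟨m, rfl⟩ := Nat.exists_eq_add_of_le hkn
  obtain ⟨Φ, e, h1, -, h3⟩ := exists_carrier_trajectory hk m le_rfl
  have hcard := fun σ : Equiv.Perm (Fin (k + m)) => card_firstLetters hkn σ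
  have he : ∀ σ, e σ = profile k (ringProfile (firstLetters k σ))
      (fun s => permCfg (k + m) σ (k + s)) m 0 := by
    intro σ
    rw [h1, ringProfile]
    simp
  have hle : ∀ σ : Equiv.Perm (Fin (k + m)), energy k (permCfg _ σ) (k + m) ≤ e σ + 2 * k := by
    intro σ
    rw [he, energy, profile_add]
    have hring := isProfile_ringProfile (firstLetters k σ)
    rw [hcard] at hring
    refine (profile_le_profile_add (a := 2 * k) hring (fun c => ?_) _
      (fun s => permCfg (k + m) σ (k + s)) m 0).trans (by simp)
    have h4 := profile_le_add k (vacuum k) (permCfg (k + m) σ) k c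
    have h5 := (isProfile_vacuum k).le_add c
    simp only [vacuum] at h4 h5
    split_ifs at h4 <;> omega
  have hge : ∀ σ : Equiv.Perm (Fin (k + m)), e σ ≤ energy k (permCfg _ σ) (k + m) + k := by
    intro σ
    rw [he, energy, profile_add]
    refine (profile_le_profile_add (a := k) ((isProfile_vacuum k).profile (permCfg (k + m) σ) k)
      (fun c => ?_) _
      (fun s => permCfg (k + m) σ (k + s)) m 0).trans (by simp)
    have h4 := ringProfile_le_card (firstLetters k σ) c
    rw [hcard] at h4
    omega
  have hdiff : |∑ σ : Equiv.Perm (Fin (k + m)), (energy k (permCfg (k + m) σ) (k + m) : ℝ) -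
      ∑ σ, (e σ : ℝ)| ≤
      (k + m).factorial * (2 * k) := by
    rw [← Finset.sum_sub_distrib]
    refine (Finset.abs_sum_le_sum_abs _ _).trans ?_
    refine (Finset.sum_le_card_nsmul _ _ (2 * k : ℝ) fun σ _ => ?_).trans
      (by simp [Fintype.card_perm])
    have h4 : (energy k (permCfg _ σ) (k + m) : ℝ) ≤ e σ + 2 * k := by exact_mod_cast hle σ
    have h5 : (e σ : ℝ) ≤ energy k (permCfg _ σ) (k + m) + k := by exact_mod_cast hge σ
    rw [abs_le]
    constructor <;> linarith
  have hk1 : (0 : ℝ) < k + 1 := by positivity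
  have h4 : ((k : ℝ) + 1) * ∑ σ, (e σ : ℝ) = m * (k * (k + m).factorial) := by exact_mod_cast h3
  have h5 : ∑ σ, (e σ : ℝ) = (k + m).factorial * (m * (k / (k + 1))) := by
    field_simp
    linarith
  have h6 : (k : ℝ) * (k / (k + 1)) ≤ k :=
    mul_le_of_le_one_right (Nat.cast_nonneg _) (by rw [div_le_one hk1]; linarith)
  have h7 : (0 : ℝ) ≤ k * (k / (k + 1)) := by positivity
  have h8 : (0 : ℝ) ≤ (k + m).factorial := Nat.cast_nonneg _
  rw [h5] at hdiff
  rw [abs_le] at hdiff ⊢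
  push_cast
  constructor <;> nlinarith [mul_le_mul_of_nonneg_left h6 h8, mul_nonneg h8 h7]

end CircularExclusion

/-! ### Lipschitz dependence on the permutation -/

theorem abs_energy_swap_mul_sub_le {n : ℕ} (k : ℕ) (a b : Fin n) (σ : Equiv.Perm (Fin n)) :
    |(energy k (permCfg n (Equiv.swap a b * σ)) n : ℝ) - energy k (permCfg n σ) n| ≤ 2 := by
  have key : ∀ X Y : ℕ → ℕ, (∀ s, X s ≠ Y s → s = σ.symm a ∨ s = σ.symm b) →
      (energy k X n : ℝ) ≤ energy k Y n + 2 := by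
    intro X Y h
    have h1 := profile_le_profile_add (V := vacuum k) (a := 0) (isProfile_vacuum k) (fun c => le_rfl) X Y n 0
    have h2 : ((Finset.range n).filter fun s => X s ≠ Y s).card ≤ 2 :=
      (Finset.card_le_card (t := {(σ.symm a : ℕ), (σ.symm b : ℕ)}) fun s hs => by
        simpa using h s (Finset.mem_filter.1 hs).2).trans Finset.card_le_two
    have h3 : energy k X n ≤ energy k Y n + 2 := by
      rw [energy, energy]
      omega
    exact_mod_cast h3
  have hne : ∀ s, permCfg n (Equiv.swap a b * σ) s ≠ permCfg n σ s →
      s = σ.symm a ∨ s = σ.symm b := by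
    intro s hs
    by_contra! hcon
    refine hs ?_
    unfold permCfg
    split_ifs with h
    · rw [Equiv.Perm.mul_apply, Equiv.swap_apply_of_ne_of_ne]
      · rintro rfl
        simp at hcon
      · rintro rfl
        simp at hcon
    · rfl
  have h1 := key _ _ hne
  have h2 := key _ _ fun s hs => hne s hs.symm
  rw [abs_le]
  constructor <;> linarith

/-! ### Concentration for functions of a uniformly random permutation -/

section Concentration

open Equiv.Perm

theorem decomposeFin_symm_swap_mul {n : ℕ} (p : Fin (n + 1)) (a b : Fin n)
    (e : Equiv.Perm (Fin n)) :
    decomposeFin.symm (p, Equiv.swap a b * e) =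
      Equiv.swap (Equiv.swap 0 p a.succ) (Equiv.swap 0 p b.succ) * decomposeFin.symm (p, e) := by
  have hne : ∀ x : Fin n, p ≠ Equiv.swap 0 p x.succ := fun x h => by
    have h1 := congrArg (Equiv.swap 0 p) h
    rw [Equiv.swap_apply_right, Equiv.swap_apply_self] at h1
    exact Fin.succ_ne_zero x h1.symm
  ext x : 1
  refine Fin.cases ?_ (fun x => ?_) x
  · rw [Equiv.Perm.mul_apply, decomposeFin_symm_apply_zero, decomposeFin_symm_apply_zero,
      Equiv.swap_apply_of_ne_of_ne (hne a) (hne b)]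
  · rw [Equiv.Perm.mul_apply, decomposeFin_symm_apply_succ, decomposeFin_symm_apply_succ,
      Equiv.swap_apply_apply]
    simp [(Fin.succ_injective n).map_swap]

theorem decomposeFin_symm_eq_swap_mul {n : ℕ} (p : Fin (n + 1)) (e : Equiv.Perm (Fin n)) :
    decomposeFin.symm (p, e) = Equiv.swap 0 p * decomposeFin.symm (0, e) := by
  ext x : 1
  refine Fin.cases ?_ (fun x => ?_) x
  · simp
  · simp

theorem sum_exp_le_of_sum_eq_zero {ι : Type*} [Fintype ι] {x : ι → ℝ} {B : ℝ} (hB : B ≤ 1)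
    (hx : ∀ i, |x i| ≤ B) (hsum : ∑ i, x i = 0) :
    ∑ i, Real.exp (x i) ≤ Fintype.card ι * Real.exp (B ^ 2) := by
  have h : ∀ i, Real.exp (x i) ≤ x i + Real.exp (B ^ 2) := by
    intro i
    have h1 := abs_le.1 (Real.abs_exp_sub_one_sub_id_le ((hx i).trans hB))
    have h2 := sq_le_sq' (abs_le.1 (hx i)).1 (abs_le.1 (hx i)).2
    have h3 := Real.add_one_le_exp (B ^ 2)
    linarith [h1.2]
  refine (Finset.sum_le_sum fun i _ => h i).trans ?_
  rw [Finset.sum_add_distrib, hsum]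
  simp

/-- Exponential moments of a function of a permutation that varies by at most `c` when two
values are exchanged. -/
theorem sum_exp_le_of_swap_lipschitz {c l : ℝ} (hl : 0 ≤ l) (hcl : 2 * c * l ≤ 1)
    {n : ℕ} {F : Equiv.Perm (Fin n) → ℝ}
    (hF : ∀ a b σ, |F (Equiv.swap a b * σ) - F σ| ≤ c) {μ : ℝ}
    (hμ : ∑ σ, F σ = n.factorial * μ) :
    ∑ σ, Real.exp (l * (F σ - μ)) ≤ n.factorial * Real.exp (n * (2 * c * l) ^ 2) := by
  induction n generalizing μ with
  | zero =>
    simp only [Fintype.sum_unique, Nat.factorial_zero, Nat.cast_one, one_mul] at hμ ⊢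
    rw [hμ, sub_self, mul_zero]
    simp
  | succ n ih =>
    have hfac : (0 : ℝ) < n.factorial := Nat.cast_pos.2 n.factorial_pos
    let ν : Fin (n + 1) → ℝ := fun p => (∑ e, F (decomposeFin.symm (p, e))) / n.factorial
    have hν : ∀ p, ∑ e, F (decomposeFin.symm (p, e)) = n.factorial * ν p := fun p =>
      (mul_div_cancel₀ _ hfac.ne').symm
    have hdecomp : ∀ G : Equiv.Perm (Fin (n + 1)) → ℝ,
        ∑ σ, G σ = ∑ p, ∑ e, G (decomposeFin.symm (p, e)) := by
      intro G
      rw [← Equiv.sum_comp decomposeFin.symm, Fintype.sum_prod_type]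
    have hνsum : ∑ p, ν p = (n + 1) * μ := by
      have h1 := hdecomp F
      rw [hμ, Finset.sum_congr rfl fun p _ => hν p, ← Finset.mul_sum, Nat.factorial_succ] at h1
      push_cast at h1
      exact (mul_left_cancel₀ hfac.ne' (by linarith)).symm
    have hν0 : ∀ p, |ν p - ν 0| ≤ c := by
      intro p
      have h1 : n.factorial * |ν p - ν 0| ≤ n.factorial * c := by
        rw [← abs_of_pos hfac, ← abs_mul, mul_sub, abs_of_pos hfac, ← hν, ← hν,
          ← Finset.sum_sub_distrib]
        refine (Finset.abs_sum_le_sum_abs _ _).trans ?_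
        refine (Finset.sum_le_card_nsmul _ _ c fun e _ => ?_).trans (by simp [Fintype.card_perm])
        rw [decomposeFin_symm_eq_swap_mul]
        exact hF _ _ _
      exact le_of_mul_le_mul_left h1 hfac
    have hνμ : ∀ p, |ν p - μ| ≤ 2 * c := by
      intro p
      have hn : (0 : ℝ) < n + 1 := by positivity
      have h1 : (n + 1) * |ν p - μ| ≤ (n + 1) * (2 * c) := by
        have h2 : (n + 1) * (ν p - μ) = ∑ q, (ν p - ν q) := by
          rw [Finset.sum_sub_distrib, hνsum]
          simp
          ring
        rw [← abs_of_pos hn, ← abs_mul, h2, abs_of_pos hn]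
        refine (Finset.abs_sum_le_sum_abs _ _).trans ?_
        refine (Finset.sum_le_card_nsmul _ _ (2 * c) fun q _ => ?_).trans (by simp)
        have h3 := abs_le.1 (hν0 p)
        have h4 := abs_le.1 (hν0 q)
        rw [abs_le]
        constructor <;> linarith
      exact le_of_mul_le_mul_left h1 hn
    have hih : ∀ p, ∑ e, Real.exp (l * (F (decomposeFin.symm (p, e)) - μ)) ≤
        Real.exp (l * (ν p - μ)) * (n.factorial * Real.exp (n * (2 * c * l) ^ 2)) := by
      intro p
      have h1 := ih (F := fun e => F (decomposeFin.symm (p, e))) (fun a b e => by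
        rw [decomposeFin_symm_swap_mul]
        exact hF _ _ _) (hν p)
      refine le_of_eq_of_le ?_ (mul_le_mul_of_nonneg_left h1 (Real.exp_pos _).le)
      rw [Finset.mul_sum]
      refine Finset.sum_congr rfl fun e _ => ?_
      rw [← Real.exp_add]
      congr 1
      ring
    have hout : ∑ p, Real.exp (l * (ν p - μ)) ≤ (n + 1) * Real.exp ((2 * c * l) ^ 2) := by
      refine (sum_exp_le_of_sum_eq_zero hcl (fun p => ?_) ?_).trans (by simp)
      · rw [abs_mul, abs_of_nonneg hl, mul_comm]
        exact mul_le_mul_of_nonneg_right (hνμ p) hl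
      · rw [← Finset.mul_sum, Finset.sum_sub_distrib, hνsum]
        simp
    rw [hdecomp]
    refine (Finset.sum_le_sum fun p _ => hih p).trans ?_
    rw [← Finset.sum_mul]
    refine (mul_le_mul_of_nonneg_right hout (by positivity)).trans_eq ?_
    rw [Nat.factorial_succ]
    push_cast
    rw [show ((n : ℝ) + 1) * (2 * c * l) ^ 2 = n * (2 * c * l) ^ 2 + (2 * c * l) ^ 2 by ring,
      Real.exp_add]
    ring

theorem card_filter_le_of_swap_lipschitz {c l : ℝ} (hl : 0 ≤ l) (hcl : 2 * c * l ≤ 1)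
    {n : ℕ} {F : Equiv.Perm (Fin n) → ℝ}
    (hF : ∀ a b σ, |F (Equiv.swap a b * σ) - F σ| ≤ c) {μ : ℝ}
    (hμ : ∑ σ, F σ = n.factorial * μ) (u : ℝ) :
    ((Finset.univ.filter fun σ => u ≤ |F σ - μ|).card : ℝ) ≤
      2 * (n.factorial * Real.exp (n * (2 * c * l) ^ 2 - l * u)) := by
  have h1 := sum_exp_le_of_swap_lipschitz hl hcl hF hμ
  have h2 := sum_exp_le_of_swap_lipschitz (F := fun σ => -F σ) (μ := -μ) hl hcl (fun a b σ => by
    rw [← abs_neg, neg_sub, sub_neg_eq_add, neg_add_eq_sub]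
    exact hF a b σ) (by rw [Finset.sum_neg_distrib, hμ, mul_neg])
  have h3 : ((Finset.univ.filter fun σ => u ≤ |F σ - μ|).card : ℝ) * Real.exp (l * u) ≤
      ∑ σ, (Real.exp (l * (F σ - μ)) + Real.exp (l * (-F σ - -μ))) := by
    rw [← nsmul_eq_mul]
    refine (Finset.card_nsmul_le_sum _ _ _ fun σ hσ => ?_).trans
      (Finset.sum_le_sum_of_subset_of_nonneg (Finset.filter_subset _ _)
        fun σ _ _ => by positivity)
    rcases le_abs.1 (Finset.mem_filter.1 hσ).2 with h | h
    · exact (Real.exp_le_exp.2 (mul_le_mul_of_nonneg_left h hl)).trans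
        (le_add_of_nonneg_right (Real.exp_pos _).le)
    · refine (Real.exp_le_exp.2 (mul_le_mul_of_nonneg_left ?_ hl)).trans
        (le_add_of_nonneg_left (Real.exp_pos _).le)
      linarith
  rw [Finset.sum_add_distrib] at h3
  rw [Real.exp_sub, mul_div_assoc', mul_div_assoc', le_div_iff₀ (Real.exp_pos _)]
  linarith

end Concentration

/-! ### Almost sure convergence -/

/-- The energy of a uniformly random permutation concentrates. -/
theorem exists_card_filter_energy_le {k : ℕ} (hk : 1 ≤ k) {ε : ℝ} (hε : 0 < ε) :
    ∃ δ : ℝ, 0 < δ ∧ ∀ n : ℕ, k ≤ n → 3 * k ≤ ε * n →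
      ((Finset.univ.filter fun σ : Equiv.Perm (Fin n) =>
        2 * ε * n ≤ |(energy k (permCfg n σ) n : ℝ) - n * (k / (k + 1))|).card : ℝ) ≤
        2 * Real.exp (-δ) ^ n * n.factorial := by
  let l := min (1 / 4) (ε / 32)
  have hl : 0 < l := lt_min (by norm_num) (by positivity)
  have hl1 : l ≤ 1 / 4 := min_le_left _ _
  have hl2 : l ≤ ε / 32 := min_le_right _ _
  refine ⟨l * ε / 2, by positivity, fun n hkn hn => ?_⟩
  have hfac : (0 : ℝ) < n.factorial := Nat.cast_pos.2 n.factorial_pos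
  let μ := (∑ σ : Equiv.Perm (Fin n), (energy k (permCfg n σ) n : ℝ)) / n.factorial
  have hμ : ∑ σ : Equiv.Perm (Fin n), (energy k (permCfg n σ) n : ℝ) = n.factorial * μ :=
    (mul_div_cancel₀ _ hfac.ne').symm
  have hmean : |μ - n * (k / (k + 1))| ≤ 3 * k := by
    have h1 := abs_sum_energy_sub_le hk hkn
    rw [hμ, ← mul_sub, abs_mul, abs_of_pos hfac] at h1
    exact le_of_mul_le_mul_left h1 hfac
  have h1 := card_filter_le_of_swap_lipschitz (c := 2) hl.le (by linarith)
    (abs_energy_swap_mul_sub_le k) hμ (ε * n)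
  have h2 : (n * (2 * 2 * l) ^ 2 - l * (ε * n) : ℝ) ≤ n * -(l * ε / 2) := by
    have h3 : (0 : ℝ) ≤ n * l := by positivity
    nlinarith
  calc _ ≤ ((Finset.univ.filter fun σ : Equiv.Perm (Fin n) =>
        ε * n ≤ |(energy k (permCfg n σ) n : ℝ) - μ|).card : ℝ) := by
        refine Nat.cast_le.2 (Finset.card_le_card (Finset.monotone_filter_right _ ?_))
        intro σ _ hσ
        have h3 := abs_sub_le (energy k (permCfg n σ) n : ℝ) μ (n * (k / (k + 1)))
        linarith
    _ ≤ _ := h1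
    _ ≤ _ := by
        rw [← Real.exp_nat_mul, mul_assoc 2 (Real.exp _), mul_comm (Real.exp _) (n.factorial : ℝ)]
        gcongr

section AlmostSure

variable {Ω : Type*} [MeasurableSpace Ω] {ℙ : Measure Ω} {σ : (n : ℕ) → Ω → Equiv.Perm (Fin n)}

theorem measure_mem_le {n : ℕ}
    (hunif : ∀ s : Equiv.Perm (Fin n), ℙ {ω | σ n ω = s} = (↑(Nat.factorial n))⁻¹)
    (A : Finset (Equiv.Perm (Fin n))) {r : ℝ} (hA : (A.card : ℝ) ≤ r * n.factorial) :
    ℙ {ω | σ n ω ∈ A} ≤ ENNReal.ofReal r := by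
  have h1 : {ω | σ n ω ∈ A} ⊆ ⋃ s ∈ A, {ω | σ n ω = s} := fun ω hω => by simpa using hω
  refine (measure_mono h1).trans ((measure_biUnion_finset_le A _).trans ?_)
  rw [Finset.sum_congr rfl fun s _ => hunif s, Finset.sum_const, nsmul_eq_mul,
    ← div_eq_mul_inv]
  refine ENNReal.div_le_of_le_mul ?_
  rw [← ENNReal.ofReal_natCast, ← ENNReal.ofReal_natCast, ← ENNReal.ofReal_mul']
  · exact ENNReal.ofReal_le_ofReal hA
  · exact Nat.cast_nonneg _

theorem ae_eventually_abs_energy_sub_lt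
    (hunif : ∀ n : ℕ, ∀ s : Equiv.Perm (Fin n),
      ℙ {ω | σ n ω = s} = (↑(Nat.factorial n))⁻¹)
    {k : ℕ} (hk : 1 ≤ k) {ε : ℝ} (hε : 0 < ε) :
    ∀ᵐ ω ∂ℙ, ∀ᶠ n : ℕ in Filter.atTop,
      |(energy k (permCfg n (σ n ω)) n : ℝ) - n * (k / (k + 1))| < 2 * ε * n := by
  obtain ⟨δ, hδ, h⟩ := exists_card_filter_energy_le hk hε
  let A : (n : ℕ) → Finset (Equiv.Perm (Fin n)) := fun n => Finset.univ.filter fun σ =>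
    2 * ε * n ≤ |(energy k (permCfg n σ) n : ℝ) - n * (k / (k + 1))|
  let s : ℕ → Set Ω := fun n => {ω | (k ≤ n ∧ 3 * k ≤ ε * n) ∧ σ n ω ∈ A n}
  have hs : ∀ n, ℙ (s n) ≤ ENNReal.ofReal (2 * Real.exp (-δ) ^ n) := by
    intro n
    by_cases hn : k ≤ n ∧ 3 * k ≤ ε * n
    · exact (measure_mono fun ω hω => hω.2).trans
        (measure_mem_le (hunif n) (A n) (h n hn.1 hn.2))
    · have : s n = ∅ := Set.eq_empty_of_forall_notMem fun ω hω => hn hω.1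
      rw [this, measure_empty]
      exact zero_le
  have hsum : Summable fun n : ℕ => 2 * Real.exp (-δ) ^ n :=
    (summable_geometric_of_lt_one (Real.exp_pos _).le (Real.exp_lt_one_iff.2 (by linarith))).mul_left 2
  have hfin : ∑' n, ℙ (s n) ≠ ⊤ :=
    ne_top_of_le_ne_top hsum.tsum_ofReal_ne_top (ENNReal.tsum_le_tsum hs)
  filter_upwards [ae_eventually_notMem hfin] with ω hω
  have hlarge : ∀ᶠ n : ℕ in Filter.atTop, (3 * k : ℝ) ≤ ε * n :=
    (tendsto_natCast_atTop_atTop.const_mul_atTop hε).eventually_ge_atTop _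
  filter_upwards [hω, Filter.eventually_ge_atTop k, hlarge] with n h1 h2 h3
  by_contra h4
  exact h1 ⟨⟨h2, h3⟩, Finset.mem_filter.2 ⟨Finset.mem_univ _, not_lt.1 h4⟩⟩

theorem ae_tendsto_energy_div
    (hunif : ∀ n : ℕ, ∀ s : Equiv.Perm (Fin n),
      ℙ {ω | σ n ω = s} = (↑(Nat.factorial n))⁻¹) (k : ℕ) :
    ∀ᵐ ω ∂ℙ, Filter.Tendsto (fun n : ℕ => (energy k (permCfg n (σ n ω)) n : ℝ) / n)
      Filter.atTop (nhds (k / (k + 1))) := by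
  rcases Nat.eq_zero_or_pos k with rfl | hk
  · simp [energy_zero_left]
  · have h : ∀ j : ℕ, ∀ᵐ ω ∂ℙ, ∀ᶠ n : ℕ in Filter.atTop,
        |(energy k (permCfg n (σ n ω)) n : ℝ) - n * (k / (k + 1))| < 2 * (1 / (j + 1)) * n :=
      fun j => ae_eventually_abs_energy_sub_lt hunif hk (by positivity)
    filter_upwards [ae_all_iff.2 h] with ω hω
    rw [Metric.tendsto_atTop']
    intro ε hε
    obtain ⟨j, hj⟩ := exists_nat_one_div_lt (half_pos hε)
    obtain ⟨N, hN⟩ := Filter.eventually_atTop.1 (hω j)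
    refine ⟨N, fun n hn => ?_⟩
    have hn0 : (0 : ℝ) < n := Nat.cast_pos.2 (by omega)
    rw [Real.dist_eq, div_sub' hn0.ne', abs_div, abs_of_pos hn0, div_lt_iff₀ hn0]
    refine (hN n hn.le).trans ?_
    gcongr
    linarith

end AlmostSure

theorem solRow_permCfg_add {n : ℕ} (σ : Equiv.Perm (Fin n)) (k : ℕ) :
    solRow (k + 1) (permCfg n σ) + energy k (permCfg n σ) n = energy (k + 1) (permCfg n σ) n := by
  refine solRow_add_energy (N := n + 1) (fun s => ?_) (fun s hs => ?_) k
  · unfold permCfg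
    split_ifs <;> omega
  · simp [permCfg, hs]

/-- If `ρ_k(n)` denotes the `k`-th row length of the invariant Young
diagram of the `n`-color BBS started from a uniformly random permutation of `{1,…,n}`,
then almost surely `n^{-1} ρ_k(n) → 1/(k(k+1))`. -/
theorem stmt12 {Ω : Type*} [MeasurableSpace Ω] (ℙ : Measure Ω) [IsProbabilityMeasure ℙ]
    (σ : (n : ℕ) → Ω → Equiv.Perm (Fin n))
    (hunif : ∀ n : ℕ, ∀ s : Equiv.Perm (Fin n),
      ℙ {ω | σ n ω = s} = (↑(Nat.factorial n))⁻¹)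
    (k : ℕ) (hk : 1 ≤ k) :
    ∀ᵐ ω ∂ℙ, Filter.Tendsto
      (fun n : ℕ => (solRow k (permCfg n (σ n ω)) : ℝ) / n)
      Filter.atTop (nhds (1 / (k * (k + 1)))) := by
  obtain ⟨k, rfl⟩ := Nat.exists_eq_add_of_le' hk
  filter_upwards [ae_tendsto_energy_div hunif (k + 1), ae_tendsto_energy_div hunif k]
    with ω h1 h2
  convert h1.sub h2 using 2 with n
  · rw [← sub_div, ← solRow_permCfg_add]
    push_cast
    ring
  · push_cast
    field_simp
    ring
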